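/- For each maximal X ∈ L let nbc_X = {B ∈ nbc : ⋂B = X}; X is unmixed if nbc_X ⊆ βnbc or nbc_X ∩ βnbc = ∅, and the linear order on 𝒜 is unmixed if every maximal X ∈ L is unmixed. Suppose the linear order on 𝒜 is unmixed and λ(X) ≠ 0 for every dense X ∈ L ∖ {V}. Then the set of residue classes {[ω_B] : B ∈ βnbc(𝒜)} is a ℂ-basis of A^r / (ω_λ ∧ A^{r−1}). -/

import Mathlib

open Module

noncomputable section

/-- An arrangement of `n` (affine) hyperplanes inside the ambient affine subspace `amb`
of the complex vector space `W`.  The linear order on the hyperplanes is the order of the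
indices in `Fin n`; an arbitrary linear order is encoded by a permutation `σ` of `Fin n`,
with `i ≺ j ↔ σ i < σ j`. -/
structure HArr (W : Type) [AddCommGroup W] [Module ℂ W] (n : ℕ) where
  amb : AffineSubspace ℂ W
  amb_ne : (amb : Set W).Nonempty
  H : Fin n → AffineSubspace ℂ W
  inj : Function.Injective H
  le_amb : ∀ i, H i ≤ amb
  nonemptyH : ∀ i, ((H i : Set W)).Nonempty
  hyp : ∀ i, finrank ℂ (H i).direction + 1 = finrank ℂ amb.direction

namespace HArr

variable {W : Type} [AddCommGroup W] [Module ℂ W] {n : ℕ}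

/-- The intersection `⋂ S` of a subset of the arrangement (the ambient space for `S = ∅`). -/
def inter (A : HArr W n) (S : Finset (Fin n)) : AffineSubspace ℂ W :=
  A.amb ⊓ S.inf A.H

/-- Codimension (inside the ambient space) of an affine subspace. -/
def cd (A : HArr W n) (X : AffineSubspace ℂ W) : ℕ :=
  finrank ℂ A.amb.direction - finrank ℂ X.direction

/-- A dependent subset of the arrangement. -/
def dep (A : HArr W n) (S : Finset (Fin n)) : Prop :=
  A.inter S ≠ ⊥ ∧ A.cd (A.inter S) < S.card

/-- An independent subset of the arrangement. -/
def indep (A : HArr W n) (S : Finset (Fin n)) : Prop :=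
  A.inter S ≠ ⊥ ∧ A.cd (A.inter S) = S.card

/-- A base: a maximal independent subset. -/
def isBase (A : HArr W n) (S : Finset (Fin n)) : Prop :=
  A.indep S ∧ ∀ T, A.indep T → S ⊆ T → S = T

open scoped Classical in
/-- The rank of a subarrangement `{H i : i ∈ C}`. -/
def rankOn (A : HArr W n) (C : Finset (Fin n)) : ℕ :=
  C.powerset.sup fun S => if A.indep S then S.card else 0

/-- The rank `r` of the arrangement. -/
def rank (A : HArr W n) : ℕ := A.rankOn Finset.univ

/-- A circuit: an inclusion-minimal dependent set. -/
def circuit (A : HArr W n) (S : Finset (Fin n)) : Prop :=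
  A.dep S ∧ ∀ T ⊂ S, ¬ A.dep T

/-- A broken circuit w.r.t. the linear order given by `σ`. -/
def brokenCircuit (A : HArr W n) (σ : Equiv.Perm (Fin n)) (S : Finset (Fin n)) : Prop :=
  ∃ i ∉ S, (∀ j ∈ S, σ i < σ j) ∧ A.circuit (insert i S)

/-- An nbc set: nonempty intersection and containing no broken circuit. -/
def nbcSet (A : HArr W n) (σ : Equiv.Perm (Fin n)) (S : Finset (Fin n)) : Prop :=
  A.inter S ≠ ⊥ ∧ ∀ T ⊆ S, ¬ A.brokenCircuit σ T

/-- An nbc-base. -/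
def nbcBase (A : HArr W n) (σ : Equiv.Perm (Fin n)) (S : Finset (Fin n)) : Prop :=
  A.nbcSet σ S ∧ A.isBase S

/-- A βnbc-base. -/
def betaNbcBase (A : HArr W n) (σ : Equiv.Perm (Fin n)) (S : Finset (Fin n)) : Prop :=
  A.nbcBase σ S ∧ ∀ i ∈ S, ∃ j, σ j < σ i ∧ A.isBase (insert j (S.erase i))

/-- Membership in the intersection poset `L(𝒜)`. -/
def memL (A : HArr W n) (X : AffineSubspace ℂ W) : Prop :=
  X ≠ ⊥ ∧ ∃ S : Finset (Fin n), A.inter S = X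

/-- A maximal element of `L(𝒜)` (in the reverse-inclusion order). -/
def maximalL (A : HArr W n) (X : AffineSubspace ℂ W) : Prop :=
  A.memL X ∧ ∀ Y, A.memL Y → Y ≤ X → Y = X

open scoped Classical in
/-- The set of indices of hyperplanes containing `X`, i.e. `𝒜_X`. -/
def sub (A : HArr W n) (X : AffineSubspace ℂ W) : Finset (Fin n) :=
  Finset.univ.filter fun i => X ≤ A.H i

/-- `X` is dense: `𝒜_X` admits no decomposition into two nonempty parts. -/
def denseL (A : HArr W n) (X : AffineSubspace ℂ W) : Prop :=
  ¬ ∃ S T : Finset (Fin n), Disjoint S T ∧ S.Nonempty ∧ T.Nonempty ∧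
      S ∪ T = A.sub X ∧ A.cd (A.inter S) + A.cd (A.inter T) = A.cd X

/-- `i` is the minimum of `S` w.r.t. the linear order given by `σ`. -/
def isMin (σ : Equiv.Perm (Fin n)) (i : Fin n) (S : Finset (Fin n)) : Prop :=
  i ∈ S ∧ ∀ j ∈ S, σ i ≤ σ j

/-- The standard ordered tuple of a finite set, w.r.t. the linear order given by `σ`:
`tup σ S p` is the element of `S` with `(p+1)`-st smallest `σ`-value. -/
def tup (σ : Equiv.Perm (Fin n)) (S : Finset (Fin n)) (p : Fin S.card) : Fin n :=
  σ.symm (((S.image ⇑σ).orderIsoOfFin (Finset.card_image_of_injective S σ.injective) p).1)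

/-- The flag `ξ(B) = (X_1 > ⋯ > X_r)` of a standard ordered base:
`flag σ S p = X_{p+1} = ⋂_{k ≥ p} H_{i_k}`. -/
def flag (A : HArr W n) (σ : Equiv.Perm (Fin n)) (S : Finset (Fin n)) (p : Fin S.card) :
    AffineSubspace ℂ W :=
  A.inter (S.filter fun i => σ (tup σ S p) ≤ σ i)

/-- Lexicographic order on standard ordered tuples (for the canonical order). -/
def lexLt (S T : Finset (Fin n)) : Prop :=
  List.Lex (· < ·) (S.sort (· ≤ ·)) (T.sort (· ≤ ·))

/-- `λ(X) = Σ_{H_i ∈ 𝒜_X} λ_i`. -/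
def lamX (A : HArr W n) (lam : Fin n → ℂ) (X : AffineSubspace ℂ W) : ℂ :=
  ∑ i ∈ A.sub X, lam i

/-- `X` is unmixed (w.r.t. the order `σ`). -/
def unmixedX (A : HArr W n) (σ : Equiv.Perm (Fin n)) (X : AffineSubspace ℂ W) : Prop :=
  (∀ S, A.nbcBase σ S → A.inter S = X → A.betaNbcBase σ S) ∨
  (∀ S, A.nbcBase σ S → A.inter S = X → ¬ A.betaNbcBase σ S)

/-- The linear order given by `σ` is unmixed. -/
def unmixedOrd (A : HArr W n) (σ : Equiv.Perm (Fin n)) : Prop :=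
  ∀ X, A.maximalL X → A.unmixedX σ X

/-- Membership in the intersection poset of the deleted arrangement `𝒜 ∖ {H_{i₀}}`. -/
def memLdel (A : HArr W n) (i₀ : Fin n) (X : AffineSubspace ℂ W) : Prop :=
  X ≠ ⊥ ∧ ∃ S : Finset (Fin n), i₀ ∉ S ∧ A.inter S = X

/-- A maximal element of the intersection poset of the deleted arrangement. -/
def maximalLdel (A : HArr W n) (i₀ : Fin n) (X : AffineSubspace ℂ W) : Prop :=
  A.memLdel i₀ X ∧ ∀ Y, A.memLdel i₀ Y → Y ≤ X → Y = X

/-- The generator `e_i` of the exterior algebra `E`. -/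
def gen (i : Fin n) : ExteriorAlgebra ℂ (Fin n → ℂ) :=
  ExteriorAlgebra.ι ℂ (Pi.single i 1)

/-- `e_S = e_{i_1} ∧ ⋯ ∧ e_{i_p}` for `S = {i_1 < ⋯ < i_p}`. -/
def eS (S : Finset (Fin n)) : ExteriorAlgebra ℂ (Fin n → ℂ) :=
  ((S.sort (· ≤ ·)).map gen).prod

/-- `∂e_S = Σ_k (−1)^{k−1} e_{S ∖ {i_k}}`. -/
def bdry (S : Finset (Fin n)) : ExteriorAlgebra ℂ (Fin n → ℂ) :=
  ∑ i ∈ S, ((-1 : ℂ) ^ (S.filter fun j => j < i).card) • eS (S.erase i)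

/-- The defining relations of the Orlik–Solomon algebra. -/
inductive OSRel (A : HArr W n) :
    ExteriorAlgebra ℂ (Fin n → ℂ) → ExteriorAlgebra ℂ (Fin n → ℂ) → Prop
  | isBot : ∀ S : Finset (Fin n), A.inter S = ⊥ → OSRel A (eS S) 0
  | isDep : ∀ S : Finset (Fin n), A.dep S → OSRel A (bdry S) 0

/-- The Orlik–Solomon algebra `A(𝒜)`: the exterior algebra modulo the ideal generated by
the `e_S` with empty intersection and the `∂e_S` with `S` dependent. -/
abbrev OS (A : HArr W n) := RingQuot (OSRel A)

/-- The quotient map `E → A(𝒜)`. -/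
def osMk (A : HArr W n) : ExteriorAlgebra ℂ (Fin n → ℂ) →ₐ[ℂ] OS A :=
  RingQuot.mkAlgHom ℂ (OSRel A)

/-- `ω_i`, the image of `e_i` in the Orlik–Solomon algebra. -/
def om (A : HArr W n) (i : Fin n) : OS A := osMk A (gen i)

/-- `ω_B`, the image of `e_B` in the Orlik–Solomon algebra. -/
def omB (A : HArr W n) (S : Finset (Fin n)) : OS A := osMk A (eS S)

/-- The degree `p` part `A^p` of the Orlik–Solomon algebra. -/
def deg (A : HArr W n) (p : ℕ) : Submodule ℂ (OS A) :=
  Submodule.span ℂ {x | ∃ S : Finset (Fin n), S.card = p ∧ x = omB A S}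

/-- `ω_λ = Σ_i λ_i ω_i`. -/
def omLam (A : HArr W n) (lam : Fin n → ℂ) : OS A := ∑ i, lam i • om A i

/-- `ω_λ(X) = Σ_{H_i ∈ 𝒜_X} λ_i ω_i`. -/
def omLamX (A : HArr W n) (lam : Fin n → ℂ) (X : AffineSubspace ℂ W) : OS A :=
  ∑ i ∈ A.sub X, lam i • om A i

/-- The form `Ξ(B) = ω_λ(X_1) ⋯ ω_λ(X_r)` attached to a standard ordered base. -/
def Xi (A : HArr W n) (σ : Equiv.Perm (Fin n)) (lam : Fin n → ℂ) (S : Finset (Fin n)) :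
    OS A :=
  ((List.finRange S.card).map fun p => A.omLamX lam (A.flag σ S p)).prod

/-- The submodule `ω_λ ∧ A^p` of the Orlik-Solomon algebra. -/
def Ideg (A : HArr W n) (lam : Fin n → ℂ) (p : ℕ) : Submodule ℂ (OS A) :=
  (A.deg p).map (LinearMap.mulLeft ℂ (A.omLam lam))

end HArr

namespace HArr

variable {W : Type} [AddCommGroup W] [Module ℂ W] {n : ℕ}

set_option linter.unusedSectionVars false

section Geometry

variable (A : HArr W n)

lemma inter_le_amb (S : Finset (Fin n)) : A.inter S ≤ A.amb := inf_le_left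

lemma le_inter_iff {X : AffineSubspace ℂ W} {S : Finset (Fin n)} :
    X ≤ A.inter S ↔ X ≤ A.amb ∧ ∀ i ∈ S, X ≤ A.H i := by
  simp [inter, Finset.le_inf_iff]

lemma inter_le_H {S : Finset (Fin n)} {i : Fin n} (hi : i ∈ S) : A.inter S ≤ A.H i :=
  ((A.le_inter_iff).1 le_rfl).2 i hi

lemma inter_anti {S T : Finset (Fin n)} (h : S ⊆ T) : A.inter T ≤ A.inter S :=
  A.le_inter_iff.2 ⟨A.inter_le_amb T, fun _ hi => A.inter_le_H (h hi)⟩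

lemma inter_ne_bot_of_subset {S T : Finset (Fin n)} (h : S ⊆ T) (hT : A.inter T ≠ ⊥) :
    A.inter S ≠ ⊥ := fun h0 => hT (le_bot_iff.1 (h0 ▸ A.inter_anti h))

lemma inter_insert (i : Fin n) (S : Finset (Fin n)) :
    A.inter (insert i S) = A.inter S ⊓ A.H i := by
  rw [inter, inter, Finset.inf_insert, inf_comm (A.H i), inf_assoc]

lemma inter_union (S T : Finset (Fin n)) :
    A.inter (S ∪ T) = A.inter S ⊓ A.inter T := by
  rw [inter, inter, inter, Finset.inf_union, inf_inf_distrib_left]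

lemma inter_empty : A.inter ∅ = A.amb := by simp [inter]

lemma inter_insert_of_le {i : Fin n} {S : Finset (Fin n)} (h : A.inter S ≤ A.H i) :
    A.inter (insert i S) = A.inter S := by
  rw [inter_insert, inf_eq_left.2 h]

lemma amb_ne_bot : A.amb ≠ ⊥ := by
  rw [← AffineSubspace.nonempty_iff_ne_bot]; exact A.amb_ne

lemma mem_sub {X : AffineSubspace ℂ W} {i : Fin n} : i ∈ A.sub X ↔ X ≤ A.H i := by
  simp [sub]

variable [FiniteDimensional ℂ W]

lemma not_amb_le (i : Fin n) : ¬ A.amb ≤ A.H i := by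
  intro h
  have h1 := A.hyp i
  rw [le_antisymm (A.le_amb i) h] at h1
  omega

lemma finrank_direction_mono {X Y : AffineSubspace ℂ W} (h : X ≤ Y) :
    finrank ℂ X.direction ≤ finrank ℂ Y.direction :=
  Submodule.finrank_mono (AffineSubspace.direction_le h)

lemma finrank_direction_inf_H {Z : AffineSubspace ℂ W} {i : Fin n} (hZ : Z ≤ A.amb)
    (hne : Z ⊓ A.H i ≠ ⊥) (hi : ¬ Z ≤ A.H i) :
    finrank ℂ (Z ⊓ A.H i).direction + 1 = finrank ℂ Z.direction := by
  obtain ⟨p, hp⟩ := (AffineSubspace.nonempty_iff_ne_bot _).2 hne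
  have hpZ : p ∈ Z := hp.1
  have hpH : p ∈ A.H i := hp.2
  rw [AffineSubspace.direction_inf_of_mem hpZ hpH]
  have h1 := Submodule.finrank_sup_add_finrank_inf_eq Z.direction (A.H i).direction
  have h2 : ¬ Z.direction ≤ (A.H i).direction := by
    intro h
    refine hi fun q hq => ?_
    have := AffineSubspace.vadd_mem_of_mem_direction
      (h (AffineSubspace.vsub_mem_direction hq hpZ)) hpH
    simpa using this
  have h3 : (A.H i).direction < Z.direction ⊔ (A.H i).direction := by
    refine lt_of_le_of_ne le_sup_right fun h => h2 ?_
    rw [h]; exact le_sup_left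
  have h4 := Submodule.finrank_lt_finrank_of_lt h3
  have h5 : Z.direction ⊔ (A.H i).direction ≤ A.amb.direction :=
    sup_le (AffineSubspace.direction_le hZ) (AffineSubspace.direction_le (A.le_amb i))
  have h6 := Submodule.finrank_mono h5
  have h7 := A.hyp i
  omega

lemma inf_H_ne_bot {Z : AffineSubspace ℂ W} {i : Fin n} (hZ : Z ≤ A.amb)
    (hne : Z ≠ ⊥) (hi : ¬ Z.direction ≤ (A.H i).direction) : Z ⊓ A.H i ≠ ⊥ := by
  obtain ⟨p, hp⟩ := (AffineSubspace.nonempty_iff_ne_bot _).2 hne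
  obtain ⟨q, hq⟩ := A.nonemptyH i
  have h3 : (A.H i).direction < Z.direction ⊔ (A.H i).direction := by
    refine lt_of_le_of_ne le_sup_right fun h => hi ?_
    rw [h]; exact le_sup_left
  have h4 := Submodule.finrank_lt_finrank_of_lt h3
  have h5 : Z.direction ⊔ (A.H i).direction ≤ A.amb.direction :=
    sup_le (AffineSubspace.direction_le hZ) (AffineSubspace.direction_le (A.le_amb i))
  have h6 : Z.direction ⊔ (A.H i).direction = A.amb.direction := by
    refine Submodule.eq_of_le_of_finrank_le h5 ?_
    have h7 := A.hyp i
    omega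
  have h8 : p -ᵥ q ∈ Z.direction ⊔ (A.H i).direction := by
    rw [h6]
    exact AffineSubspace.vsub_mem_direction (hZ hp) (A.le_amb i hq)
  obtain ⟨u, hu, v, hv, huv⟩ := Submodule.mem_sup.1 h8
  rw [← AffineSubspace.nonempty_iff_ne_bot]
  refine ⟨v +ᵥ q, ?_, AffineSubspace.vadd_mem_of_mem_direction hv hq⟩
  have : v +ᵥ q = (-u) +ᵥ p := by
    simp only [vadd_eq_add, vsub_eq_sub] at huv ⊢
    rw [← sub_eq_zero]
    have : v + q - (-u + p) = (u + v) - (p - q) := by abel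
    rw [this, huv, sub_self]
  rw [this]
  exact AffineSubspace.vadd_mem_of_mem_direction (neg_mem hu) hp

lemma cd_insert {i : Fin n} {S : Finset (Fin n)} (hne : A.inter (insert i S) ≠ ⊥)
    (hi : ¬ A.inter S ≤ A.H i) : A.cd (A.inter (insert i S)) = A.cd (A.inter S) + 1 := by
  rw [inter_insert] at hne ⊢
  have h1 := A.finrank_direction_inf_H (A.inter_le_amb S) hne hi
  have h2 := finrank_direction_mono (A.inter_le_amb S)
  simp only [cd]
  omega

lemma cd_union_le {S T : Finset (Fin n)} (hne : A.inter (S ∪ T) ≠ ⊥) :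
    A.cd (A.inter (S ∪ T)) ≤ A.cd (A.inter S) + T.card := by
  induction T using Finset.induction_on with
  | empty => simp
  | insert i T hi ih =>
    rw [Finset.union_insert] at hne ⊢
    have ih' := ih (A.inter_ne_bot_of_subset (Finset.subset_insert _ _) hne)
    rw [Finset.card_insert_of_notMem hi]
    by_cases h : A.inter (S ∪ T) ≤ A.H i
    · rw [A.inter_insert_of_le h]; omega
    · rw [A.cd_insert hne h]; omega

lemma cd_amb : A.cd A.amb = 0 := by simp [cd]

lemma cd_le_card {S : Finset (Fin n)} (hne : A.inter S ≠ ⊥) : A.cd (A.inter S) ≤ S.card := by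
  have := A.cd_union_le (S := ∅) (T := S) (by simpa using hne)
  simpa [inter_empty, cd_amb] using this

lemma cd_anti {X Y : AffineSubspace ℂ W} (h : X ≤ Y) : A.cd Y ≤ A.cd X := by
  have := finrank_direction_mono h
  simp only [cd]; omega

lemma eq_of_le_of_cd_le {X Y : AffineSubspace ℂ W} (hX : X ≠ ⊥) (h : X ≤ Y) (hY : Y ≤ A.amb)
    (hcd : A.cd X ≤ A.cd Y) : X = Y := by
  have h1 := finrank_direction_mono h
  have h2 := finrank_direction_mono hY
  simp only [cd] at hcd
  refine AffineSubspace.eq_of_direction_eq_of_nonempty_of_le ?_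
    ((AffineSubspace.nonempty_iff_ne_bot _).2 hX) h
  exact Submodule.eq_of_le_of_finrank_le (AffineSubspace.direction_le h) (by omega)

variable {A}

lemma indep_empty : A.indep ∅ := by
  refine ⟨by rw [inter_empty]; exact A.amb_ne_bot, by simp [inter_empty, cd_amb]⟩

lemma not_dep_iff {S : Finset (Fin n)} (hne : A.inter S ≠ ⊥) : ¬ A.dep S ↔ A.indep S := by
  have := A.cd_le_card hne
  simp only [dep, indep, hne, ne_eq, not_false_eq_true, true_and]
  omega

lemma indep.not_dep {S : Finset (Fin n)} (h : A.indep S) : ¬ A.dep S := (not_dep_iff h.1).2 h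

lemma indep.subset {S T : Finset (Fin n)} (hS : A.indep S) (h : T ⊆ S) : A.indep T := by
  have hT := A.inter_ne_bot_of_subset h hS.1
  refine ⟨hT, ?_⟩
  have h1 := A.cd_le_card hT
  have h2 := A.cd_union_le (S := T) (T := S \ T) (by rw [Finset.union_sdiff_of_subset h]; exact hS.1)
  rw [Finset.union_sdiff_of_subset h, hS.2, Finset.card_sdiff_of_subset h] at h2
  have := Finset.card_le_card h
  omega

lemma notMem_of_not_le {i : Fin n} {S : Finset (Fin n)} (h : ¬ A.inter S ≤ A.H i) : i ∉ S :=
  fun hi => h (A.inter_le_H hi)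

lemma indep.insert {i : Fin n} {S : Finset (Fin n)} (hS : A.indep S)
    (hne : A.inter (insert i S) ≠ ⊥) (hi : ¬ A.inter S ≤ A.H i) : A.indep (insert i S) :=
  ⟨hne, by rw [A.cd_insert hne hi, hS.2, Finset.card_insert_of_notMem (notMem_of_not_le hi)]⟩

lemma indep.not_le {i : Fin n} {S : Finset (Fin n)} (hS : A.indep (Insert.insert i S))
    (hi : i ∉ S) : ¬ A.inter S ≤ A.H i := by
  intro h
  have h1 := hS.2
  have h2 := hS.1
  rw [A.inter_insert_of_le h] at h1 h2
  have := A.cd_le_card h2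
  rw [Finset.card_insert_of_notMem hi] at h1
  omega

lemma indep_singleton (i : Fin n) : A.indep {i} := by
  rw [← insert_empty_eq]
  refine indep_empty.insert ?_ ?_
  · rw [inter_insert, inter_empty, inf_eq_right.2 (A.le_amb i)]
    exact (AffineSubspace.nonempty_iff_ne_bot _).1 (A.nonemptyH i)
  · rw [inter_empty]; exact A.not_amb_le i

lemma indep.augment {S T : Finset (Fin n)} (hS : A.indep S) (hT : A.indep T)
    (h : S.card < T.card) : ∃ j ∈ T, j ∉ S ∧ A.indep (Insert.insert j S) := by
  have key : ∃ j ∈ T, ¬ (A.inter S).direction ≤ (A.H j).direction := by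
    by_contra! hc
    obtain ⟨p, hp⟩ := (AffineSubspace.nonempty_iff_ne_bot _).2 hT.1
    have h1 : (A.inter S).direction ≤ (A.inter T).direction := by
      intro v hv
      have : v +ᵥ p ∈ A.inter T := by
        have hle : ∀ X : AffineSubspace ℂ W, p ∈ X → v ∈ X.direction → v +ᵥ p ∈ X :=
          fun X hp hv => AffineSubspace.vadd_mem_of_mem_direction hv hp
        have h3 : (AffineSubspace.mk' (v +ᵥ p) ⊥ : AffineSubspace ℂ W) ≤ A.inter T := by
          refine A.le_inter_iff.2 ⟨?_, fun i hi => ?_⟩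
          · intro q hq
            rw [AffineSubspace.mem_mk', Submodule.mem_bot, vsub_eq_zero_iff_eq] at hq
            rw [hq]
            exact hle _ (A.inter_le_amb T hp)
              (AffineSubspace.direction_le (A.inter_le_amb S) hv)
          · intro q hq
            rw [AffineSubspace.mem_mk', Submodule.mem_bot, vsub_eq_zero_iff_eq] at hq
            rw [hq]
            exact hle _ (A.inter_le_H hi hp) (hc i hi hv)
        exact h3 (AffineSubspace.self_mem_mk' _ _)
      simpa using AffineSubspace.vsub_mem_direction this hp
    have h2 := Submodule.finrank_mono h1
    have h3 := hS.2
    have h4 := hT.2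
    simp only [cd] at h3 h4
    omega
  obtain ⟨j, hj, hdir⟩ := key
  have hnle : ¬ A.inter S ≤ A.H j := fun h => hdir (AffineSubspace.direction_le h)
  refine ⟨j, hj, notMem_of_not_le hnle, hS.insert ?_ hnle⟩
  rw [inter_insert]
  exact A.inf_H_ne_bot (A.inter_le_amb S) hS.1 hdir

lemma exists_indep_superset {S T : Finset (Fin n)} (hS : A.indep S) (hST : S ⊆ T)
    (hT : A.inter T ≠ ⊥) : ∃ I, A.indep I ∧ S ⊆ I ∧ I ⊆ T ∧ A.inter I = A.inter T := by
  classical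
  obtain ⟨I, hI, hmax⟩ := Finset.exists_max_image
    (T.powerset.filter fun I => A.indep I ∧ S ⊆ I) Finset.card ⟨S, by simp [hS, hST]⟩
  simp only [Finset.mem_filter, Finset.mem_powerset] at hI hmax
  refine ⟨I, hI.2.1, hI.2.2, hI.1, le_antisymm ?_ (A.inter_anti hI.1)⟩
  refine A.le_inter_iff.2 ⟨A.inter_le_amb I, fun i hi => ?_⟩
  by_contra hc
  have h1 := hI.2.1.insert
    (A.inter_ne_bot_of_subset (Finset.insert_subset hi hI.1) hT) hc
  have h2 := hmax _ ⟨Finset.insert_subset hi hI.1, h1, hI.2.2.trans (Finset.subset_insert _ _)⟩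
  rw [Finset.card_insert_of_notMem (notMem_of_not_le hc)] at h2
  omega

lemma inter_eq_of_indep {S : Finset (Fin n)} {X : AffineSubspace ℂ W} (hS : A.indep S)
    (hX : X ≠ ⊥) (h : X ≤ A.inter S) (hcd : A.cd X ≤ S.card) : A.inter S = X :=
  (A.eq_of_le_of_cd_le hX h (A.inter_le_amb S) (hcd.trans hS.2.ge)).symm

lemma inter_sub {X : AffineSubspace ℂ W} (hX : A.memL X) : A.inter (A.sub X) = X := by
  obtain ⟨S, rfl⟩ := hX.2
  refine le_antisymm (A.inter_anti fun i hi => A.mem_sub.2 (A.inter_le_H hi)) ?_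
  exact A.le_inter_iff.2 ⟨A.inter_le_amb S, fun i hi => A.mem_sub.1 hi⟩

lemma indep.card_le_rank {S : Finset (Fin n)} (hS : A.indep S) : S.card ≤ A.rank := by
  classical
  have := Finset.le_sup (f := fun S => if A.indep S then S.card else 0)
    (Finset.mem_powerset.2 (Finset.subset_univ S))
  simp only [hS, if_true] at this
  exact this.trans (le_of_eq rfl)

lemma exists_indep_card_eq_rank : ∃ S, A.indep S ∧ S.card = A.rank := by
  classical
  obtain ⟨S, -, hS⟩ := Finset.exists_mem_eq_sup (Finset.univ : Finset (Fin n)).powerset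
    ⟨∅, by simp⟩ (fun S => if A.indep S then S.card else 0)
  have hS' : A.rank = if A.indep S then S.card else 0 := by
    rw [← hS]; rfl
  by_cases h : A.indep S
  · exact ⟨S, h, by rw [hS', if_pos h]⟩
  · exact ⟨∅, indep_empty, by rw [hS', if_neg h]; rfl⟩

lemma isBase_iff {S : Finset (Fin n)} : A.isBase S ↔ A.indep S ∧ S.card = A.rank := by
  constructor
  · rintro ⟨h, hmax⟩
    refine ⟨h, le_antisymm h.card_le_rank ?_⟩
    obtain ⟨T, hT, hTr⟩ := A.exists_indep_card_eq_rank
    by_contra! hc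
    obtain ⟨j, -, hj, hjS⟩ := h.augment hT (by omega)
    exact hj (hmax _ hjS (Finset.subset_insert _ _) ▸ Finset.mem_insert_self _ _)
  · rintro ⟨h, hr⟩
    exact ⟨h, fun T hT hST => Finset.eq_of_subset_of_card_le hST (hr ▸ hT.card_le_rank)⟩

lemma isBase.exchange {B B' : Finset (Fin n)} (hB : A.isBase B) (hB' : A.isBase B')
    {i : Fin n} (hi : i ∈ B) (hi' : i ∉ B') :
    ∃ j ∈ B', j ∉ B ∧ A.isBase (insert j (B.erase i)) := by
  rw [isBase_iff] at hB hB'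
  have hpos := Finset.card_pos.2 ⟨i, hi⟩
  obtain ⟨j, hj, hjB, hind⟩ := (hB.1.subset (Finset.erase_subset i B)).augment hB'.1
    (by rw [Finset.card_erase_of_mem hi]; omega)
  refine ⟨j, hj, fun h => hjB (Finset.mem_erase.2 ⟨?_, h⟩), isBase_iff.2 ⟨hind, ?_⟩⟩
  · rintro rfl; exact hi' hj
  · rw [Finset.card_insert_of_notMem hjB, Finset.card_erase_of_mem hi]; omega

end Geometry

section Exterior

lemma eS_empty : eS (∅ : Finset (Fin n)) = 1 := by simp [eS]

lemma eS_insert_min {a : Fin n} {S : Finset (Fin n)} (h : ∀ b ∈ S, a < b) :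
    eS (insert a S) = gen a * eS S := by
  rw [eS, Finset.sort_insert _ (fun b hb => (h b hb).le) (fun ha => lt_irrefl _ (h a ha)),
    List.map_cons, List.prod_cons, eS]

lemma gen_mul_gen_swap (i j : Fin n) : gen i * gen j = -(gen j * gen i) :=
  eq_neg_of_add_eq_zero_left (ExteriorAlgebra.ι_add_mul_swap _ _)

lemma gen_mul_gen_self (i : Fin n) : gen i * gen i = 0 := ExteriorAlgebra.ι_sq_zero _

/-- The sign of inserting `i` into the increasing list of elements of `S`. -/
def insSign (i : Fin n) (S : Finset (Fin n)) : ℂ := (-1) ^ (S.filter fun j => j < i).card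

lemma insSign_mul_self (i : Fin n) (S : Finset (Fin n)) : insSign i S * insSign i S = 1 := by
  rw [insSign, ← mul_pow]; simp

lemma insSign_ne_zero (i : Fin n) (S : Finset (Fin n)) : insSign i S ≠ 0 :=
  left_ne_zero_of_mul_eq_one (insSign_mul_self i S)

lemma insSign_eq_one {i : Fin n} {S : Finset (Fin n)} (h : ∀ b ∈ S, i < b) :
    insSign i S = 1 := by
  rw [insSign, Finset.filter_false_of_mem fun b hb => (h b hb).not_gt]; simp

lemma insSign_insert {i a : Fin n} {S : Finset (Fin n)} (ha : a ∉ S) (h : a < i) :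
    insSign i (insert a S) = -insSign i S := by
  rw [insSign, insSign, Finset.filter_insert, if_pos h, Finset.card_insert_of_notMem (by simp [ha]),
    pow_succ, mul_neg_one]

lemma gen_mul_eS {i : Fin n} {S : Finset (Fin n)} (hi : i ∉ S) :
    gen i * eS S = insSign i S • eS (insert i S) := by
  induction S using Finset.induction_on_min with
  | empty =>
    rw [insSign_eq_one (by simp), one_smul, eS_insert_min (by simp)]
  | insert a S ha ih =>
    have haS : a ∉ S := fun h => lt_irrefl _ (ha a h)
    simp only [Finset.mem_insert, not_or] at hi
    rcases lt_or_gt_of_ne hi.1 with h | h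
    · have h' : ∀ b ∈ insert a S, i < b := by
        intro b hb
        rcases Finset.mem_insert.1 hb with rfl | hb
        · exact h
        · exact h.trans (ha b hb)
      rw [insSign_eq_one h', one_smul, eS_insert_min h']
    · have h' : ∀ b ∈ insert i S, a < b := by
        intro b hb
        rcases Finset.mem_insert.1 hb with rfl | hb
        · exact h
        · exact ha b hb
      rw [Finset.insert_comm, eS_insert_min h', eS_insert_min ha, insSign_insert haS h,
        ← mul_assoc, gen_mul_gen_swap, neg_mul, mul_assoc, ih hi.2, mul_smul_comm, neg_smul]

lemma eS_eq_smul_of_mem {i : Fin n} {S : Finset (Fin n)} (hi : i ∈ S) :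
    eS S = insSign i (S.erase i) • (gen i * eS (S.erase i)) := by
  rw [gen_mul_eS (Finset.notMem_erase i S), smul_smul, insSign_mul_self, one_smul,
    Finset.insert_erase hi]

lemma gen_mul_eS_of_mem {i : Fin n} {S : Finset (Fin n)} (hi : i ∈ S) : gen i * eS S = 0 := by
  rw [eS_eq_smul_of_mem hi, mul_smul_comm, ← mul_assoc, gen_mul_gen_self, zero_mul, smul_zero]

/-- The sum of coordinates. -/
def sumDual (ι : Type) [Fintype ι] : Module.Dual ℂ (ι → ℂ) := ∑ i, LinearMap.proj i

lemma sumDual_single {ι : Type} [Fintype ι] [DecidableEq ι] (i : ι) :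
    sumDual ι (Pi.single i 1) = 1 := by
  simp [sumDual]

/-- The derivation `∂` of the exterior algebra sending all coordinate vectors to `1`. -/
def del (ι : Type) [Fintype ι] :
    ExteriorAlgebra ℂ (ι → ℂ) →ₗ[ℂ] ExteriorAlgebra ℂ (ι → ℂ) :=
  CliffordAlgebra.contractLeft (sumDual ι)

lemma del_one {ι : Type} [Fintype ι] : del ι 1 = 0 :=
  CliffordAlgebra.contractLeft_one (Q := (0 : QuadraticForm ℂ (ι → ℂ))) _

lemma del_ι_mul {ι : Type} [Fintype ι] (v : ι → ℂ) (x : ExteriorAlgebra ℂ (ι → ℂ)) :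
    del ι (ExteriorAlgebra.ι ℂ v * x) = sumDual ι v • x - ExteriorAlgebra.ι ℂ v * del ι x :=
  CliffordAlgebra.contractLeft_ι_mul _ _ _

lemma del_gen_mul (i : Fin n) (x : ExteriorAlgebra ℂ (Fin n → ℂ)) :
    del (Fin n) (gen i * x) = x - gen i * del (Fin n) x := by
  rw [gen, del_ι_mul, sumDual_single, one_smul]

lemma del_eS (S : Finset (Fin n)) : del (Fin n) (eS S) = bdry S := by
  induction S using Finset.induction_on_min with
  | empty => simp [eS_empty, del_one, bdry]
  | insert a S ha ih =>
    have haS : a ∉ S := fun h => lt_irrefl _ (ha a h)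
    rw [eS_insert_min ha, del_gen_mul, ih, bdry.eq_1 (insert a S), Finset.sum_insert haS, sub_eq_add_neg]
    congr 1
    · rw [Finset.erase_insert haS, Finset.filter_insert, if_neg (lt_irrefl a),
        Finset.filter_false_of_mem fun b hb => (ha b hb).not_gt]
      simp
    · rw [bdry, Finset.mul_sum, ← Finset.sum_neg_distrib]
      refine Finset.sum_congr rfl fun i hi => ?_
      have h := insSign_insert haS (ha i hi)
      rw [insSign, insSign] at h
      rw [h, Finset.erase_insert_of_ne (ha i hi).ne,
        eS_insert_min fun b hb => ha b (Finset.mem_of_mem_erase hb), mul_smul_comm, neg_smul]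

lemma eS_ne_zero (S : Finset (Fin n)) : eS S ≠ 0 := by
  have key : ∀ (a : Fin n) (S : Finset (Fin n)), a ∉ S →
      CliffordAlgebra.contractLeft (Q := (0 : QuadraticForm ℂ (Fin n → ℂ)))
        (LinearMap.proj a : (Fin n → ℂ) →ₗ[ℂ] ℂ) (eS S) = 0 := by
    intro a S
    induction S using Finset.induction_on_min with
    | empty => intro _; rw [eS_empty]; exact CliffordAlgebra.contractLeft_one (Q := (0 : QuadraticForm ℂ (Fin n → ℂ))) _
    | insert b S hb ih =>
      intro ha
      simp only [Finset.mem_insert, not_or] at ha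
      rw [eS_insert_min hb, gen, ExteriorAlgebra.ι, CliffordAlgebra.contractLeft_ι_mul, ih ha.2]
      simp [ha.1]
  induction S using Finset.induction_on_min with
  | empty => rw [eS_empty]; exact one_ne_zero
  | insert a S ha ih =>
    intro h
    have haS : a ∉ S := fun h => lt_irrefl _ (ha a h)
    refine ih ?_
    have h2 := congrArg (CliffordAlgebra.contractLeft (Q := (0 : QuadraticForm ℂ (Fin n → ℂ)))
        (LinearMap.proj a : (Fin n → ℂ) →ₗ[ℂ] ℂ)) h
    rw [eS_insert_min ha, gen, ExteriorAlgebra.ι, CliffordAlgebra.contractLeft_ι_mul,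
      key a S haS] at h2
    simpa using h2

/-- The linear map permuting/collapsing coordinate vectors along `f`. -/
def collapse {ι : Type} [Fintype ι] [DecidableEq ι] (f : Fin n → ι) :
    (Fin n → ℂ) →ₗ[ℂ] (ι → ℂ) :=
  (Pi.basisFun ℂ (Fin n)).constr ℂ fun i => Pi.single (f i) 1

lemma collapse_single {ι : Type} [Fintype ι] [DecidableEq ι] (f : Fin n → ι) (i : Fin n) :
    collapse f (Pi.single i 1) = Pi.single (f i) 1 := by
  have := (Pi.basisFun ℂ (Fin n)).constr_basis ℂ
    (fun i => (Pi.single (f i) 1 : ι → ℂ)) i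
  rwa [Pi.basisFun_apply] at this

lemma map_collapse_gen {ι : Type} [Fintype ι] [DecidableEq ι] (f : Fin n → ι) (i : Fin n) :
    ExteriorAlgebra.map (collapse f) (gen i) = ExteriorAlgebra.ι ℂ (Pi.single (f i) 1) := by
  rw [gen, ExteriorAlgebra.map_apply_ι, collapse_single]

lemma map_collapse_bdry {ι : Type} [Fintype ι] [DecidableEq ι] (f : Fin n → ι)
    (S : Finset (Fin n)) : ExteriorAlgebra.map (collapse f) (bdry S) =
      del ι (ExteriorAlgebra.map (collapse f) (eS S)) := by
  rw [← del_eS]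
  induction S using Finset.induction_on_min with
  | empty => simp [eS_empty, del_one]
  | insert a S ha ih =>
    rw [eS_insert_min ha, del_gen_mul, map_sub, map_mul, map_mul, ih, map_collapse_gen, del_ι_mul,
      sumDual_single, one_smul]

lemma map_collapse_eS_eq_zero {ι : Type} [Fintype ι] [DecidableEq ι] (f : Fin n → ι)
    {S : Finset (Fin n)} {i j : Fin n} (hi : i ∈ S) (hj : j ∈ S) (hij : i ≠ j) (h : f i = f j) :
    ExteriorAlgebra.map (collapse f) (eS S) = 0 := by
  rw [eS_eq_smul_of_mem hi, eS_eq_smul_of_mem (Finset.mem_erase.2 ⟨hij.symm, hj⟩), map_smul,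
    map_mul, map_smul, map_mul, map_collapse_gen, map_collapse_gen, h, mul_smul_comm, ← mul_assoc,
    ExteriorAlgebra.ι_sq_zero, zero_mul, smul_zero, smul_zero]

/-- Forgetting the coordinate `none`. -/
def forget : (Option (Fin n) → ℂ) →ₗ[ℂ] (Fin n → ℂ) := LinearMap.funLeft ℂ ℂ some

lemma forget_some (i : Fin n) : forget (Pi.single (some i) 1) = Pi.single i 1 := by
  ext j
  by_cases h : j = i
  · subst h; simp [forget, LinearMap.funLeft_apply]
  · simp [forget, LinearMap.funLeft_apply, h]

lemma forget_none : forget (n := n) (Pi.single none 1) = 0 := by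
  ext j
  simp [forget, LinearMap.funLeft_apply]

/-- The algebra endomorphism sending `e_i` to `e_{f i}`, or to `0` when `f i = none`. -/
def layerHom (f : Fin n → Option (Fin n)) :
    ExteriorAlgebra ℂ (Fin n → ℂ) →ₐ[ℂ] ExteriorAlgebra ℂ (Fin n → ℂ) :=
  (ExteriorAlgebra.map forget).comp (ExteriorAlgebra.map (collapse f))

lemma layerHom_gen_some {f : Fin n → Option (Fin n)} {i j : Fin n} (h : f i = some j) :
    layerHom f (gen i) = gen j := by
  rw [layerHom, AlgHom.comp_apply, map_collapse_gen, ExteriorAlgebra.map_apply_ι, h, forget_some,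
    gen]

lemma layerHom_gen_none {f : Fin n → Option (Fin n)} {i : Fin n} (h : f i = none) :
    layerHom f (gen i) = 0 := by
  rw [layerHom, AlgHom.comp_apply, map_collapse_gen, ExteriorAlgebra.map_apply_ι, h, forget_none,
    map_zero]

lemma layerHom_eS_of_none {f : Fin n → Option (Fin n)} {S : Finset (Fin n)} {i : Fin n}
    (hi : i ∈ S) (h : f i = none) : layerHom f (eS S) = 0 := by
  rw [eS_eq_smul_of_mem hi, map_smul, map_mul, layerHom_gen_none h, zero_mul, smul_zero]

lemma layerHom_eS_of_not_inj {f : Fin n → Option (Fin n)} {S : Finset (Fin n)} {i j : Fin n}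
    (hi : i ∈ S) (hj : j ∈ S) (hij : i ≠ j) (h : f i = f j) : layerHom f (eS S) = 0 := by
  rw [layerHom, AlgHom.comp_apply, map_collapse_eS_eq_zero f hi hj hij h, map_zero]

lemma layerHom_bdry_of_not_inj {f : Fin n → Option (Fin n)} {S : Finset (Fin n)} {i j : Fin n}
    (hi : i ∈ S) (hj : j ∈ S) (hij : i ≠ j) (h : f i = f j) : layerHom f (bdry S) = 0 := by
  rw [layerHom, AlgHom.comp_apply, map_collapse_bdry, map_collapse_eS_eq_zero f hi hj hij h,
    map_zero, map_zero]

lemma layerHom_eS_of_fixed {f : Fin n → Option (Fin n)} {S : Finset (Fin n)}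
    (h : ∀ i ∈ S, f i = some i) : layerHom f (eS S) = eS S := by
  induction S using Finset.induction_on_min with
  | empty => rw [eS_empty, map_one]
  | insert a S ha ih =>
    rw [eS_insert_min ha, map_mul, layerHom_gen_some (h a (Finset.mem_insert_self _ _)),
      ih fun i hi => h i (Finset.mem_insert_of_mem hi)]

end Exterior

section OrlikSolomon

variable [FiniteDimensional ℂ W] {A : HArr W n}

lemma osMk_eq_of_rel {x y : ExteriorAlgebra ℂ (Fin n → ℂ)} (h : OSRel A x y) :
    osMk A x = osMk A y := RingQuot.mkAlgHom_rel ℂ h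

lemma omB_eq_zero_of_bot {S : Finset (Fin n)} (h : A.inter S = ⊥) : A.omB S = 0 := by
  rw [omB, osMk_eq_of_rel (OSRel.isBot S h), map_zero]

lemma osMk_bdry {S : Finset (Fin n)} (h : A.dep S) : osMk A (bdry S) = 0 := by
  rw [osMk_eq_of_rel (OSRel.isDep S h), map_zero]

lemma omB_eq_zero_of_dep {S : Finset (Fin n)} (h : A.dep S) : A.omB S = 0 := by
  have hne : S.Nonempty := by
    rw [Finset.nonempty_iff_ne_empty]; rintro rfl
    exact absurd h.2 (by simp)
  obtain ⟨i, hi⟩ := hne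
  have h1 := del_gen_mul i (eS S)
  rw [gen_mul_eS_of_mem hi, map_zero, del_eS] at h1
  rw [omB, sub_eq_zero.1 h1.symm, map_mul, osMk_bdry h, mul_zero]

lemma omB_eq_zero {S : Finset (Fin n)} (h : ¬ A.indep S) : A.omB S = 0 := by
  by_cases h0 : A.inter S = ⊥
  · exact omB_eq_zero_of_bot h0
  · refine omB_eq_zero_of_dep ?_
    by_contra h1
    exact h ((not_dep_iff h0).1 h1)

lemma om_mul_omB_of_mem {i : Fin n} {S : Finset (Fin n)} (hi : i ∈ S) :
    A.om i * A.omB S = 0 := by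
  rw [om, omB, ← map_mul, gen_mul_eS_of_mem hi, map_zero]

lemma om_mul_omB {i : Fin n} {S : Finset (Fin n)} (hi : i ∉ S) :
    A.om i * A.omB S = insSign i S • A.omB (insert i S) := by
  rw [om, omB, ← map_mul, gen_mul_eS hi, map_smul, omB]

/-- The vector with coordinates `λ_i` for `i ∈ sub X` and `0` elsewhere. -/
def vecX (A : HArr W n) (lam : Fin n → ℂ) (X : AffineSubspace ℂ W) : Fin n → ℂ :=
  ∑ i ∈ A.sub X, lam i • Pi.single i (1 : ℂ)

lemma omLamX_eq (lam : Fin n → ℂ) (X : AffineSubspace ℂ W) :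
    A.omLamX lam X = osMk A (ExteriorAlgebra.ι ℂ (A.vecX lam X)) := by
  simp only [omLamX, vecX, map_sum, map_smul, om, gen]

lemma omLamX_mul_self (lam : Fin n → ℂ) (X : AffineSubspace ℂ W) :
    A.omLamX lam X * A.omLamX lam X = 0 := by
  rw [omLamX_eq, ← map_mul, ExteriorAlgebra.ι_sq_zero, map_zero]

lemma omLamX_mul_swap (lam : Fin n → ℂ) (X Y : AffineSubspace ℂ W) :
    A.omLamX lam X * A.omLamX lam Y = -(A.omLamX lam Y * A.omLamX lam X) := by
  rw [omLamX_eq, omLamX_eq, ← map_mul (osMk A), ← map_mul (osMk A), ← map_neg,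
    eq_neg_of_add_eq_zero_left (ExteriorAlgebra.ι_add_mul_swap _ _)]

lemma omLam_mul_self (lam : Fin n → ℂ) : A.omLam lam * A.omLam lam = 0 := by
  have : A.omLam lam = osMk A (ExteriorAlgebra.ι ℂ (∑ i, lam i • Pi.single i (1 : ℂ))) := by
    simp only [omLam, map_sum, map_smul, om, gen]
  rw [this, ← map_mul, ExteriorAlgebra.ι_sq_zero, map_zero]

/-- Pushing `∂` through `ω_λ(X)`: for an independent set `S` spanning `X`,
`λ(X) ω_S = ω_λ(X) ∂ω_S`. -/
lemma lamX_smul_omB (lam : Fin n → ℂ) (S : Finset (Fin n)) (hS : A.inter S ≠ ⊥) :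
    A.lamX lam (A.inter S) • A.omB S = A.omLamX lam (A.inter S) * osMk A (bdry S) := by
  rw [lamX, omLamX, Finset.sum_smul, Finset.sum_mul]
  refine Finset.sum_congr rfl fun i hi => ?_
  rw [smul_mul_assoc]
  congr 1
  have h1 := congrArg (osMk A) (del_gen_mul i (eS S))
  have h2 : osMk A (del (Fin n) (gen i * eS S)) = 0 := by
    by_cases h : i ∈ S
    · rw [gen_mul_eS_of_mem h, map_zero, map_zero]
    · rw [gen_mul_eS h, map_smul, del_eS, map_smul, osMk_bdry, smul_zero]
      rw [mem_sub] at hi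
      rw [dep, A.inter_insert_of_le hi, Finset.card_insert_of_notMem h]
      exact ⟨hS, Nat.lt_succ_of_le (A.cd_le_card hS)⟩
  rw [h2, del_eS, map_sub, map_mul] at h1
  exact sub_eq_zero.1 h1.symm

end OrlikSolomon

section Nbc

variable [FiniteDimensional ℂ W] {A : HArr W n}

/-- A description of nbc sets: `S` is independent, and each `b ∈ S` is the least index of a
hyperplane through the intersection of the elements of `S` from `b` on. -/
def IsNbc (A : HArr W n) (S : Finset (Fin n)) : Prop :=
  A.indep S ∧ ∀ b ∈ S, ∀ i, A.inter (S.filter (b ≤ ·)) ≤ A.H i → b ≤ i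

lemma exists_circuit_subset {S : Finset (Fin n)} (hS : A.dep S) : ∃ C ⊆ S, A.circuit C := by
  classical
  obtain ⟨C, hC, hmin⟩ := Finset.exists_min_image
    (S.powerset.filter fun C => A.dep C) Finset.card ⟨S, by simp [hS]⟩
  simp only [Finset.mem_filter, Finset.mem_powerset] at hC hmin
  refine ⟨C, hC.1, hC.2, fun T hT hd => ?_⟩
  exact absurd (hmin T ⟨hT.1.trans hC.1, hd⟩) (not_le.2 (Finset.card_lt_card hT))

lemma not_dep_empty : ¬ A.dep ∅ := indep_empty.not_dep

lemma circuit.erase_indep {C : Finset (Fin n)} (hC : A.circuit C) {i : Fin n} (hi : i ∈ C) :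
    A.indep (C.erase i) :=
  (not_dep_iff (A.inter_ne_bot_of_subset (Finset.erase_subset i C) hC.1.1)).1
    (hC.2 _ (Finset.erase_ssubset hi))

lemma circuit.le_H {C : Finset (Fin n)} (hC : A.circuit C) {i : Fin n} (hi : i ∈ C) :
    A.inter (C.erase i) ≤ A.H i := by
  by_contra h
  have h1 := (hC.erase_indep hi).insert (by rw [Finset.insert_erase hi]; exact hC.1.1) h
  rw [Finset.insert_erase hi] at h1
  exact h1.not_dep hC.1

lemma brokenCircuit_one_iff {T : Finset (Fin n)} :
    A.brokenCircuit 1 T ↔ ∃ i ∉ T, (∀ j ∈ T, i < j) ∧ A.circuit (insert i T) := by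
  simp [brokenCircuit]

lemma brokenCircuit_erase {C : Finset (Fin n)} (hC : A.circuit C) {i : Fin n} (hi : i ∈ C)
    (hmin : ∀ j ∈ C, i ≤ j) : A.brokenCircuit 1 (C.erase i) := by
  rw [brokenCircuit_one_iff]
  refine ⟨i, Finset.notMem_erase i C, fun j hj => ?_, by rwa [Finset.insert_erase hi]⟩
  rw [Finset.mem_erase] at hj
  exact lt_of_le_of_ne (hmin j hj.2) (Ne.symm hj.1)

lemma dep_insert_of_le {i : Fin n} {S : Finset (Fin n)} (hS : A.indep S) (hi : i ∉ S)
    (h : A.inter S ≤ A.H i) : A.dep (insert i S) := by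
  by_contra hd
  refine ((not_dep_iff ?_).1 hd).not_le hi h
  rw [A.inter_insert_of_le h]; exact hS.1

lemma nbcSet_iff {S : Finset (Fin n)} : A.nbcSet 1 S ↔ A.IsNbc S := by
  constructor
  · rintro ⟨hne, h⟩
    have hind : A.indep S := by
      rw [← not_dep_iff hne]
      intro hd
      obtain ⟨C, hCS, hC⟩ := exists_circuit_subset hd
      have hCne : C.Nonempty := by
        rw [Finset.nonempty_iff_ne_empty]; rintro rfl; exact not_dep_empty hC.1
      exact h _ ((Finset.erase_subset _ _).trans hCS)
        (brokenCircuit_erase hC (C.min'_mem hCne) fun j hj => C.min'_le j hj)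
    refine ⟨hind, fun b hb i hi => ?_⟩
    by_contra! hib
    have hiT : i ∉ S.filter (b ≤ ·) := by simp [hib]
    have hTi := hind.subset (Finset.filter_subset (b ≤ ·) S)
    obtain ⟨C, hCS, hC⟩ := exists_circuit_subset (dep_insert_of_le hTi hiT hi)
    have hCi : i ∈ C := by
      by_contra hCi
      exact (hTi.subset ((Finset.subset_insert_iff_of_notMem hCi).1 hCS)).not_dep hC.1
    have hsub := Finset.subset_insert_iff.1 hCS
    refine h (C.erase i) (hsub.trans (Finset.filter_subset _ _))
      (brokenCircuit_erase hC hCi fun j hj => ?_)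
    rcases Finset.mem_insert.1 (hCS hj) with rfl | hj
    · exact le_rfl
    · exact hib.le.trans (Finset.mem_filter.1 hj).2
  · rintro ⟨hind, h⟩
    refine ⟨hind.1, fun T hTS hT => ?_⟩
    obtain ⟨i, hiT, hlt, hC⟩ := brokenCircuit_one_iff.1 hT
    have hTne : T.Nonempty := by
      rw [Finset.nonempty_iff_ne_empty]; rintro rfl
      exact (indep_singleton i).not_dep (by simpa using hC.1)
    have hle := hC.le_H (Finset.mem_insert_self i T)
    rw [Finset.erase_insert hiT] at hle
    have hmem := T.min'_mem hTne
    refine absurd (h _ (hTS hmem) i ((A.inter_anti fun j hj => ?_).trans hle))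
      (not_le.2 (hlt _ hmem))
    exact Finset.mem_filter.2 ⟨hTS hj, T.min'_le j hj⟩

lemma IsNbc.subset {S T : Finset (Fin n)} (hS : A.IsNbc S) (h : T ⊆ S) : A.IsNbc T :=
  ⟨hS.1.subset h, fun b hb i hi => hS.2 b (h hb) i
    ((A.inter_anti (Finset.filter_subset_filter _ h)).trans hi)⟩

lemma isNbc_empty : A.IsNbc ∅ := ⟨indep_empty, by simp⟩

lemma filter_le_min {a : Fin n} {S : Finset (Fin n)} (h : ∀ b ∈ S, a < b) :
    (insert a S).filter (a ≤ ·) = insert a S :=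
  Finset.filter_true_of_mem fun b hb => by
    rcases Finset.mem_insert.1 hb with rfl | hb
    exacts [le_rfl, (h b hb).le]

lemma filter_le_of_mem {a b : Fin n} {S : Finset (Fin n)} (h : ∀ b ∈ S, a < b) (hb : b ∈ S) :
    (insert a S).filter (b ≤ ·) = S.filter (b ≤ ·) := by
  rw [Finset.filter_insert, if_neg (not_le.2 (h b hb))]

lemma isNbc_insert_iff {a : Fin n} {S : Finset (Fin n)} (h : ∀ b ∈ S, a < b) :
    A.IsNbc (insert a S) ↔ A.IsNbc S ∧ A.indep (insert a S) ∧
      ∀ i, A.inter (insert a S) ≤ A.H i → a ≤ i := by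
  constructor
  · intro hS
    refine ⟨hS.subset (Finset.subset_insert _ _), hS.1, fun i hi => ?_⟩
    exact hS.2 a (Finset.mem_insert_self _ _) i (by rwa [filter_le_min h])
  · rintro ⟨hS, hind, hmin⟩
    refine ⟨hind, fun b hb i hi => ?_⟩
    rcases Finset.mem_insert.1 hb with rfl | hb
    · exact hmin i (by rwa [filter_le_min h] at hi)
    · exact hS.2 b hb i (by rwa [filter_le_of_mem h hb] at hi)

lemma IsNbc.exists_le {S : Finset (Fin n)} (hS : A.IsNbc S) {i : Fin n}
    (hi : A.inter S ≤ A.H i) : ∃ b ∈ S, b ≤ i := by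
  have hne : S.Nonempty := by
    rw [Finset.nonempty_iff_ne_empty]; rintro rfl
    rw [inter_empty] at hi; exact A.not_amb_le i hi
  refine ⟨_, S.min'_mem hne, hS.2 _ (S.min'_mem hne) i ?_⟩
  rwa [Finset.filter_true_of_mem fun b hb => S.min'_le b hb]

end Nbc

section Layer

variable [FiniteDimensional ℂ W] {A : HArr W n}

open scoped Classical in
/-- The elements `b` of `B` such that `H i` contains the intersection of the members of `B`
from `b` on. -/
def layerSet (A : HArr W n) (B : Finset (Fin n)) (i : Fin n) : Finset (Fin n) :=
  B.filter fun b => A.inter (B.filter (b ≤ ·)) ≤ A.H i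

/-- The layer of `i` with respect to `B`: the largest `b ∈ B` such that `H i` contains the
intersection of the members of `B` from `b` on. -/
def layer (A : HArr W n) (B : Finset (Fin n)) (i : Fin n) : Option (Fin n) :=
  if h : (A.layerSet B i).Nonempty then some ((A.layerSet B i).max' h) else none

lemma mem_layerSet {B : Finset (Fin n)} {i b : Fin n} :
    b ∈ A.layerSet B i ↔ b ∈ B ∧ A.inter (B.filter (b ≤ ·)) ≤ A.H i := by
  simp [layerSet]

lemma layer_eq_some {B : Finset (Fin n)} {i b : Fin n} (h : A.layer B i = some b) :
    b ∈ A.layerSet B i ∧ ∀ c ∈ A.layerSet B i, c ≤ b := by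
  unfold layer at h
  split_ifs at h with hne
  cases h
  exact ⟨Finset.max'_mem _ _, fun c hc => Finset.le_max' _ c hc⟩

lemma layer_eq_none {B : Finset (Fin n)} {i : Fin n} (h : A.layer B i = none) :
    ∀ c, c ∉ A.layerSet B i := by
  unfold layer at h
  split_ifs at h with hne
  simpa [Finset.not_nonempty_iff_eq_empty, Finset.eq_empty_iff_forall_notMem] using hne

lemma not_le_of_layer_eq_none {B : Finset (Fin n)} {i : Fin n} (h : A.layer B i = none) :
    ¬ A.inter B ≤ A.H i := by
  intro hle
  have hne : B.Nonempty := by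
    rw [Finset.nonempty_iff_ne_empty]; rintro rfl
    rw [inter_empty] at hle; exact A.not_amb_le i hle
  refine layer_eq_none h (B.min' hne) (mem_layerSet.2 ⟨B.min'_mem hne, ?_⟩)
  rwa [Finset.filter_true_of_mem fun b hb => B.min'_le b hb]

/-- The members of `B` strictly above a layer; everything in case of the layer `none`. -/
def above (B : Finset (Fin n)) : Option (Fin n) → Finset (Fin n)
  | none => B
  | some b => B.filter (b < ·)

lemma not_le_above {B : Finset (Fin n)} {i : Fin n} :
    ¬ A.inter (above B (A.layer B i)) ≤ A.H i := by
  cases h : A.layer B i with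
  | none => exact not_le_of_layer_eq_none h
  | some b =>
    intro hle
    simp only [above] at hle
    have hne : (B.filter (b < ·)).Nonempty := by
      rw [Finset.nonempty_iff_ne_empty]; intro h0
      rw [h0, inter_empty] at hle; exact A.not_amb_le i hle
    have hm := Finset.mem_filter.1 (Finset.min'_mem _ hne)
    refine absurd ((layer_eq_some h).2 ((B.filter (b < ·)).min' hne)
      (mem_layerSet.2 ⟨hm.1, ?_⟩)) (not_le.2 hm.2)
    refine (A.inter_anti fun j hj => ?_).trans hle
    exact Finset.mem_filter.2 ⟨(Finset.mem_filter.1 hj).1, Finset.min'_le _ j hj⟩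

/-- The height of a layer. -/
def layerHeight : Option (Fin n) → ℕ
  | none => 0
  | some b => b + 1

lemma layerHeight_injective : Function.Injective (layerHeight (n := n)) := by
  intro x y h
  cases x <;> cases y <;> simp [layerHeight] at h ⊢
  exact Fin.ext h

lemma indep_of_layer_injOn {B S : Finset (Fin n)} (hne : A.inter S ≠ ⊥)
    (hinj : Set.InjOn (A.layer B) S) : A.indep S := by
  induction hk : S.card generalizing S with
  | zero => rw [Finset.card_eq_zero.1 hk]; exact indep_empty
  | succ k ih =>
    obtain ⟨i, hi, hmin⟩ := Finset.exists_min_image S (fun i => layerHeight (A.layer B i))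
      (Finset.card_pos.1 (by omega))
    have h1 : A.indep (S.erase i) :=
      ih (A.inter_ne_bot_of_subset (Finset.erase_subset i S) hne)
        (hinj.mono (Finset.coe_subset.2 (Finset.erase_subset i S)))
        (by rw [Finset.card_erase_of_mem hi]; omega)
    rw [← Finset.insert_erase hi]
    refine h1.insert (by rwa [Finset.insert_erase hi]) fun hle => ?_
    refine not_le_above (B := B) (i := i) (le_trans ?_ hle)
    refine (A.le_inter_iff).2 ⟨A.inter_le_amb _, fun j hj => ?_⟩
    rw [Finset.mem_erase] at hj
    have hlt : layerHeight (A.layer B i) < layerHeight (A.layer B j) :=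
      lt_of_le_of_ne (hmin j hj.2) fun h =>
        hj.1 (hinj hj.2 hi (layerHeight_injective h.symm))
    cases hlj : A.layer B j with
    | none => rw [hlj] at hlt; simp [layerHeight] at hlt
    | some c =>
      have hc := mem_layerSet.1 (layer_eq_some hlj).1
      refine le_trans (A.inter_anti fun x hx => ?_) hc.2
      cases hli : A.layer B i with
      | none => exact (Finset.mem_filter.1 hx).1
      | some b =>
        rw [hlj, hli] at hlt
        simp only [layerHeight] at hlt
        have hx := Finset.mem_filter.1 hx
        refine Finset.mem_filter.2 ⟨hx.1, lt_of_lt_of_le ?_ hx.2⟩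
        exact Fin.lt_def.2 (by omega)

lemma layerHom_rel {B : Finset (Fin n)} (hB : A.isBase B)
    {x y : ExteriorAlgebra ℂ (Fin n → ℂ)} (h : OSRel A x y) :
    layerHom (A.layer B) x = layerHom (A.layer B) y := by
  cases h with
  | isBot S hS =>
    rw [map_zero]
    have hex : ∃ i ∈ S, A.layer B i = none := by
      by_contra! hc
      refine hB.1.1 (le_bot_iff.1 (hS ▸ A.le_inter_iff.2 ⟨A.inter_le_amb _, fun i hi => ?_⟩))
      obtain ⟨b, hb⟩ := Option.ne_none_iff_exists'.1 (hc i hi)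
      exact (A.inter_anti (Finset.filter_subset _ _)).trans
        (mem_layerSet.1 (layer_eq_some hb).1).2
    obtain ⟨i, hi, hn⟩ := hex
    exact layerHom_eS_of_none hi hn
  | isDep S hS =>
    rw [map_zero]
    have hex : ∃ i ∈ S, ∃ j ∈ S, i ≠ j ∧ A.layer B i = A.layer B j := by
      by_contra! hc
      exact (indep_of_layer_injOn hS.1 fun i hi j hj h => by
        by_contra hij; exact hc i hi j hj hij h).not_dep hS
    obtain ⟨i, hi, j, hj, hij, h⟩ := hex
    exact layerHom_bdry_of_not_inj hi hj hij h

/-- The algebra map `A(𝒜) → E` determined by the layers of a base. -/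
def osLayer {B : Finset (Fin n)} (hB : A.isBase B) :
    OS A →ₐ[ℂ] ExteriorAlgebra ℂ (Fin n → ℂ) :=
  RingQuot.liftAlgHom ℂ ⟨layerHom (A.layer B), fun _ _ h => layerHom_rel hB h⟩

lemma osLayer_omB {B : Finset (Fin n)} (hB : A.isBase B) (S : Finset (Fin n)) :
    osLayer hB (A.omB S) = layerHom (A.layer B) (eS S) := by
  rw [osLayer, omB, osMk, RingQuot.liftAlgHom_mkAlgHom_apply]

lemma IsNbc.layer_self {B : Finset (Fin n)} (hB : A.IsNbc B) {b : Fin n} (hb : b ∈ B) :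
    A.layer B b = some b := by
  have hmem : b ∈ A.layerSet B b :=
    mem_layerSet.2 ⟨hb, A.inter_le_H (Finset.mem_filter.2 ⟨hb, le_rfl⟩)⟩
  cases h : A.layer B b with
  | none => exact absurd hmem (layer_eq_none h b)
  | some c =>
    obtain ⟨h1, h2⟩ := layer_eq_some h
    rw [mem_layerSet] at h1
    exact congrArg some (le_antisymm (hB.2 c h1.1 b h1.2) (h2 b hmem))

/-- If the layer map of an nbc base `B` does not kill `ω_S`, then `S` dominates `B`. -/
lemma IsNbc.sum_lt_of_osLayer_ne_zero {B S : Finset (Fin n)} (hB : A.IsNbc B) (hb : A.isBase B)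
    (hcard : S.card = B.card) (h : osLayer hb (A.omB S) ≠ 0) (hne : S ≠ B) :
    ∑ i ∈ B, (i : ℕ) < ∑ i ∈ S, (i : ℕ) := by
  rw [osLayer_omB] at h
  have hsome : ∀ i ∈ S, ∃ b, A.layer B i = some b := fun i hi =>
    Option.ne_none_iff_exists'.1 fun h0 => h (layerHom_eS_of_none hi h0)
  choose! f hf using hsome
  have hfB : ∀ i ∈ S, f i ∈ B := fun i hi =>
    (mem_layerSet.1 (layer_eq_some (hf i hi)).1).1
  have hfle : ∀ i ∈ S, f i ≤ i := fun i hi => hB.2 _ (hfB i hi) i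
    (mem_layerSet.1 (layer_eq_some (hf i hi)).1).2
  have hinj : Set.InjOn f S := fun i hi j hj hij => by
    by_contra hne
    exact h (layerHom_eS_of_not_inj hi hj hne (by rw [hf i hi, hf j hj, hij]))
  have himg : S.image f = B := by
    refine Finset.eq_of_subset_of_card_le (Finset.image_subset_iff.2 hfB) ?_
    rw [Finset.card_image_of_injOn hinj, hcard]
  have hsum : ∑ i ∈ B, (i : ℕ) = ∑ i ∈ S, (f i : ℕ) := by
    rw [← himg, Finset.sum_image hinj]
  rw [hsum]
  refine Finset.sum_lt_sum (fun i hi => hfle i hi) ?_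
  by_contra! hc
  refine hne (himg ▸ ?_)
  have : ∀ i ∈ S, f i = i := fun i hi => le_antisymm (hfle i hi) (hc i hi)
  rw [Finset.image_congr (g := id) (fun i hi => this i hi), Finset.image_id]

/-- The nbc monomials of top degree are linearly independent. -/
theorem linearIndependent_nbc :
    LinearIndependent ℂ fun B : {B : Finset (Fin n) // A.IsNbc B ∧ A.isBase B} =>
      A.omB B.1 := by
  classical
  rw [Fintype.linearIndependent_iff]
  intro c hc
  by_contra! hex
  obtain ⟨B, hB, hmax⟩ := Finset.exists_max_image
    (Finset.univ.filter fun B : {B : Finset (Fin n) // A.IsNbc B ∧ A.isBase B} => c B ≠ 0)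
    (fun B => ∑ i ∈ B.1, (i : ℕ)) (by obtain ⟨B, hB⟩ := hex; exact ⟨B, by simp [hB]⟩)
  simp only [Finset.mem_filter, Finset.mem_univ, true_and] at hB hmax
  have h := congrArg (osLayer B.2.2) hc
  rw [map_sum, map_zero, Finset.sum_eq_single B] at h
  · rw [map_smul, osLayer_omB, layerHom_eS_of_fixed fun i hi => B.2.1.layer_self hi] at h
    exact (smul_ne_zero hB (eS_ne_zero _)) h
  · intro B' _ hne
    rw [map_smul]
    by_cases h0 : c B' = 0
    · rw [h0, zero_smul]
    by_cases h1 : osLayer B.2.2 (A.omB B'.1) = 0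
    · rw [h1, smul_zero]
    refine absurd (B.2.1.sum_lt_of_osLayer_ne_zero B.2.2 ?_ h1 fun h => hne (Subtype.ext h))
      (not_lt.2 (hmax B' h0))
    rw [(isBase_iff.1 B'.2.2).2, (isBase_iff.1 B.2.2).2]
  · simp

end Layer

section FlagForms

variable [FiniteDimensional ℂ W] {A : HArr W n} (lam : Fin n → ℂ)

/-- The product of the forms `ω_λ(X)` over the flag of intersections attached to `S`. -/
def flagForm (A : HArr W n) (lam : Fin n → ℂ) (S : Finset (Fin n)) : OS A :=
  ((S.sort (· ≤ ·)).map fun b => A.omLamX lam (A.inter (S.filter (b ≤ ·)))).prod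

lemma flagForm_empty : A.flagForm lam ∅ = 1 := by simp [flagForm]

lemma flagForm_insert_min {a : Fin n} {S : Finset (Fin n)} (h : ∀ b ∈ S, a < b) :
    A.flagForm lam (insert a S) = A.omLamX lam (A.inter (insert a S)) * A.flagForm lam S := by
  rw [flagForm, Finset.sort_insert _ (fun b hb => (h b hb).le) (fun ha => lt_irrefl _ (h a ha)),
    List.map_cons, List.prod_cons, flagForm, filter_le_min h]
  congr 2
  refine List.map_congr_left fun b hb => ?_
  rw [filter_le_of_mem h ((Finset.mem_sort _).1 hb)]

lemma sub_amb : A.sub A.amb = ∅ := by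
  ext i; simp [mem_sub, not_amb_le]

lemma omLamX_amb : A.omLamX lam A.amb = 0 := by simp [omLamX, sub_amb]

lemma omLamX_inter_mul_flagForm (S : Finset (Fin n)) :
    A.omLamX lam (A.inter S) * A.flagForm lam S = 0 := by
  induction S using Finset.induction_on_min with
  | empty => rw [inter_empty, omLamX_amb, zero_mul]
  | insert a S h => rw [flagForm_insert_min lam h, ← mul_assoc, omLamX_mul_self, zero_mul]

/-- The part of the Orlik–Solomon algebra spanned by monomials supported on the flat `X`. -/
def flatPart (A : HArr W n) (X : AffineSubspace ℂ W) : Submodule ℂ (OS A) :=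
  Submodule.span ℂ {x | ∃ T, A.indep T ∧ A.inter T = X ∧ x = A.omB T}

lemma om_mul_mem_flatPart {i : Fin n} {X Y : AffineSubspace ℂ W} {y : OS A} (hX : X ≠ ⊥)
    (hXY : X ≤ Y) (hi : X ≤ A.H i) (hcd : A.cd X ≤ A.cd Y + 1) (hy : y ∈ A.flatPart Y) :
    A.om i * y ∈ A.flatPart X := by
  refine Submodule.span_induction (p := fun y _ => A.om i * y ∈ A.flatPart X)
    ?_ ?_ ?_ ?_ hy
  · rintro _ ⟨T, hT, rfl, rfl⟩
    by_cases hiT : i ∈ T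
    · rw [om_mul_omB_of_mem hiT]; exact zero_mem _
    rw [om_mul_omB hiT]
    by_cases hind : A.indep (insert i T)
    · refine Submodule.smul_mem _ _ (Submodule.subset_span ⟨_, hind, ?_, rfl⟩)
      refine inter_eq_of_indep hind hX ?_ ?_
      · rw [inter_insert]; exact le_inf hXY hi
      · rw [Finset.card_insert_of_notMem hiT, ← hT.2]; exact hcd
    · rw [omB_eq_zero hind, smul_zero]; exact zero_mem _
  · rw [mul_zero]; exact zero_mem _
  · intro x y _ _ hx hy; rw [mul_add]; exact add_mem hx hy
  · intro c x _ hx; rw [mul_smul_comm]; exact Submodule.smul_mem _ _ hx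

lemma om_mul_flatPart_eq_zero {i : Fin n} {Y : AffineSubspace ℂ W} {y : OS A}
    (h : Y ⊓ A.H i = ⊥) (hy : y ∈ A.flatPart Y) : A.om i * y = 0 := by
  refine Submodule.span_induction (p := fun y _ => A.om i * y = 0) ?_ ?_ ?_ ?_ hy
  · rintro _ ⟨T, hT, rfl, rfl⟩
    by_cases hiT : i ∈ T
    · exact om_mul_omB_of_mem hiT
    rw [om_mul_omB hiT, omB_eq_zero_of_bot (by rwa [inter_insert]), smul_zero]
  · rw [mul_zero]
  · intro x y _ _ hx hy; rw [mul_add, hx, hy, add_zero]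
  · intro c x _ hx; rw [mul_smul_comm, hx, smul_zero]

lemma omLamX_mul_mem_flatPart {X Y : AffineSubspace ℂ W} {y : OS A} (hX : X ≠ ⊥)
    (hXY : X ≤ Y) (hcd : A.cd X ≤ A.cd Y + 1) (hy : y ∈ A.flatPart Y) :
    A.omLamX lam X * y ∈ A.flatPart X := by
  rw [omLamX, Finset.sum_mul]
  refine Submodule.sum_mem _ fun i hi => ?_
  rw [smul_mul_assoc]
  exact Submodule.smul_mem _ _ (om_mul_mem_flatPart hX hXY (A.mem_sub.1 hi) hcd hy)

lemma flagForm_mem_flatPart {S : Finset (Fin n)} (hS : A.indep S) :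
    A.flagForm lam S ∈ A.flatPart (A.inter S) := by
  induction S using Finset.induction_on_min with
  | empty =>
    rw [flagForm_empty]
    exact Submodule.subset_span ⟨∅, indep_empty, rfl, by rw [omB, eS_empty, map_one]⟩
  | insert a S h ih =>
    have hS' := hS.subset (Finset.subset_insert a S)
    rw [flagForm_insert_min lam h]
    refine omLamX_mul_mem_flatPart lam hS.1 (A.inter_anti (Finset.subset_insert a S)) ?_ (ih hS')
    rw [hS.2, hS'.2]
    exact Finset.card_insert_le _ _

open scoped Classical in
/-- The contribution of `j` to the expansion of `ω_λ Ξ(S)` in flag forms. -/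
def flagTerm (A : HArr W n) (lam : Fin n → ℂ) (S : Finset (Fin n)) (j : Fin n) : OS A :=
  if j ∉ S ∧ A.IsNbc (insert j S) then insSign j S • A.flagForm lam (insert j S) else 0

lemma flagTerm_eq_zero_of_le {S : Finset (Fin n)} {j : Fin n} (h : A.inter S ≤ A.H j) :
    A.flagTerm lam S j = 0 := by
  rw [flagTerm, if_neg]
  rintro ⟨hj, hn⟩
  exact hn.1.not_le hj h

lemma sum_omLamX_mul_flagForm {S : Finset (Fin n)} (X : AffineSubspace ℂ W)
    (hXS : X ≤ A.inter S) :
    ∑ i ∈ A.sub X \ A.sub (A.inter S), lam i • (A.om i * A.flagForm lam S) =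
      A.omLamX lam X * A.flagForm lam S := by
  have hsub : A.sub (A.inter S) ⊆ A.sub X := fun i hi =>
    A.mem_sub.2 (hXS.trans (A.mem_sub.1 hi))
  have h0 := omLamX_inter_mul_flagForm (A := A) lam S
  rw [omLamX, Finset.sum_mul] at h0
  rw [omLamX, Finset.sum_mul, ← Finset.sum_sdiff hsub, h0, add_zero]
  simp only [smul_mul_assoc]

lemma sum_flagTerm_sdiff {S : Finset (Fin n)} (X : AffineSubspace ℂ W)
    (hXS : X ≤ A.inter S) :
    ∑ i ∈ A.sub X \ A.sub (A.inter S), A.flagTerm lam S i = ∑ i ∈ A.sub X, A.flagTerm lam S i := by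
  have hsub : A.sub (A.inter S) ⊆ A.sub X := fun i hi =>
    A.mem_sub.2 (hXS.trans (A.mem_sub.1 hi))
  rw [← Finset.sum_sdiff hsub, Finset.sum_eq_zero (s := A.sub (A.inter S)), add_zero]
  exact fun i hi => flagTerm_eq_zero_of_le lam (A.mem_sub.1 hi)

lemma inter_insert_eq_of_le {S : Finset (Fin n)} {i j : Fin n}
    (hi : A.indep (insert i S)) (hj : A.indep (insert j S)) (hiS : i ∉ S) (hjS : j ∉ S)
    (h : A.inter (insert i S) ≤ A.H j) : A.inter (insert j S) = A.inter (insert i S) := by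
  refine inter_eq_of_indep hj hi.1 ?_ ?_
  · rw [A.inter_insert j]
    exact le_inf (A.inter_anti (Finset.subset_insert _ _)) h
  · rw [hi.2, Finset.card_insert_of_notMem hiS, Finset.card_insert_of_notMem hjS]

/-- From single flats to saturated sets of hyperplanes. -/
lemma sum_flagTerm_of_saturated {S : Finset (Fin n)}
    (hflat : ∀ X, A.memL X → X ≤ A.inter S → A.cd X = S.card + 1 →
      A.omLamX lam X * A.flagForm lam S = ∑ j ∈ A.sub X, A.flagTerm lam S j)
    {I : Finset (Fin n)} (hI : ∀ i ∈ I, i ∉ S ∧ A.indep (insert i S))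
    (hsat : ∀ i ∈ I, ∀ j, A.inter (insert i S) ≤ A.H j → ¬ A.inter S ≤ A.H j → j ∈ I) :
    ∑ i ∈ I, lam i • (A.om i * A.flagForm lam S) = ∑ j ∈ I, A.flagTerm lam S j := by
  classical
  rw [← Finset.sum_fiberwise_of_maps_to (t := I.image fun i => A.inter (insert i S))
      (g := fun i => A.inter (insert i S)) (fun i hi => Finset.mem_image_of_mem _ hi),
    ← Finset.sum_fiberwise_of_maps_to (t := I.image fun i => A.inter (insert i S))
      (g := fun i => A.inter (insert i S)) (fun i hi => Finset.mem_image_of_mem _ hi)]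
  refine Finset.sum_congr rfl fun X hX => ?_
  obtain ⟨i, hi, rfl⟩ := Finset.mem_image.1 hX
  obtain ⟨hiS, hind⟩ := hI i hi
  have hle : A.inter (insert i S) ≤ A.inter S := A.inter_anti (Finset.subset_insert _ _)
  have hfib : I.filter (fun j => A.inter (insert j S) = A.inter (insert i S)) =
      A.sub (A.inter (insert i S)) \ A.sub (A.inter S) := by
    ext j
    simp only [Finset.mem_filter, Finset.mem_sdiff, mem_sub]
    constructor
    · rintro ⟨hj, h⟩
      refine ⟨h ▸ A.inter_le_H (Finset.mem_insert_self _ _), ?_⟩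
      exact (hI j hj).2.not_le (hI j hj).1
    · rintro ⟨h1, h2⟩
      have hj := hsat i hi j h1 h2
      exact ⟨hj, inter_insert_eq_of_le hind (hI j hj).2 hiS (hI j hj).1 h1⟩
  rw [hfib, sum_omLamX_mul_flagForm lam _ hle, sum_flagTerm_sdiff lam _ hle]
  exact hflat _ ⟨hind.1, _, rfl⟩ hle (by rw [hind.2, Finset.card_insert_of_notMem hiS])

/-- Multiplication of a flag form by `ω_λ(X)` for a flat `X` one step further down. -/
theorem omLamX_mul_flagForm {S : Finset (Fin n)} (hS : A.IsNbc S) (X : AffineSubspace ℂ W)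
    (hX : A.memL X) (hXS : X ≤ A.inter S) (hcd : A.cd X = S.card + 1) :
    A.omLamX lam X * A.flagForm lam S = ∑ j ∈ A.sub X, A.flagTerm lam S j := by
  classical
  induction S using Finset.induction_on_min generalizing X with
  | empty => exact aux ∅ hS X hX hXS hcd (by simp)
  | insert a S ha ih =>
    have haS : a ∉ S := fun h => lt_irrefl _ (ha a h)
    have haX : a ∈ A.sub X := A.mem_sub.2 (hXS.trans (A.inter_le_H (Finset.mem_insert_self _ _)))
    by_cases hmin : ∀ j ∈ A.sub X, a ≤ j
    swap
    · refine aux _ hS X hX hXS hcd fun b hb => ?_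
      push Not at hmin
      obtain ⟨j, hj, hja⟩ := hmin
      refine ⟨j, hj, ?_⟩
      rcases Finset.mem_insert.1 hb with rfl | hb
      exacts [hja, hja.trans (ha b hb)]
    have hS' := hS.subset (Finset.subset_insert a S)
    have hXS' : X ≤ A.inter S := hXS.trans (A.inter_anti (Finset.subset_insert a S))
    have hSsub : ∀ b ∈ insert a S, b ∈ A.sub (A.inter (insert a S)) := fun b hb =>
      A.mem_sub.2 (A.inter_le_H hb)
    have hind : ∀ j ∈ A.sub X \ A.sub (A.inter (insert a S)),
        A.indep (insert j (insert a S)) := by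
      intro j hj
      rw [Finset.mem_sdiff, mem_sub, mem_sub] at hj
      refine hS.1.insert (fun h0 => hX.1 (le_bot_iff.1 ?_)) hj.2
      rw [← h0, inter_insert]
      exact le_inf hXS hj.1
    have hsumI : ∑ i ∈ A.sub X \ A.sub (A.inter (insert a S)),
          lam i • (A.om i * A.flagForm lam S) =
        ∑ i ∈ A.sub X \ A.sub (A.inter (insert a S)), A.flagTerm lam S i := by
      refine sum_flagTerm_of_saturated lam (fun X h1 h2 h3 => ih hS' X h1 h2 h3) ?_ ?_
      · intro i hi
        refine ⟨fun h => (Finset.mem_sdiff.1 hi).2 (hSsub i (Finset.mem_insert_of_mem h)), ?_⟩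
        exact (hind i hi).subset (Finset.insert_subset_insert _ (Finset.subset_insert _ _))
      · intro i hi j hj hjS
        have hii := (hind i hi).subset
          (Finset.insert_subset_insert i (Finset.subset_insert a S))
        have hi' := Finset.mem_sdiff.1 hi
        have hiS : i ∉ S := fun h => hi'.2 (hSsub i (Finset.mem_insert_of_mem h))
        rw [mem_sub, mem_sub] at hi'
        have hjn := notMem_of_not_le hjS
        rw [Finset.mem_sdiff, mem_sub, mem_sub]
        refine ⟨le_trans ?_ hj, fun hY => hi'.2 ?_⟩
        · rw [inter_insert]; exact le_inf hXS' hi'.1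
        · have hjind : A.indep (insert j S) := by
            refine hS'.1.insert (fun h0 => hii.1 (le_bot_iff.1 ?_)) hjS
            rw [← h0, A.inter_insert j]
            exact le_inf (A.inter_anti (Finset.subset_insert _ _)) hj
          rw [← inter_insert_eq_of_le hS.1 hjind haS hjn hY,
            inter_insert_eq_of_le hii hjind hiS hjn hj]
          exact A.inter_le_H (Finset.mem_insert_self _ _)
    have hterm : ∀ j ∈ A.sub X \ A.sub (A.inter (insert a S)),
        A.flagTerm lam (insert a S) j = -(A.omLamX lam X * A.flagTerm lam S j) := by
      intro j hj
      have hj' := Finset.mem_sdiff.1 hj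
      have hjS : j ∉ insert a S := fun h => hj'.2 (hSsub j h)
      have haj : a < j := lt_of_le_of_ne (hmin j hj'.1) fun h =>
        hjS (h ▸ Finset.mem_insert_self _ _)
      have hamin : ∀ b ∈ insert j S, a < b := fun b hb => by
        rcases Finset.mem_insert.1 hb with rfl | hb
        exacts [haj, ha b hb]
      have hXeq : A.inter (insert a (insert j S)) = X := by
        rw [Finset.insert_comm]
        refine inter_eq_of_indep (hind j hj) hX.1 ?_ ?_
        · rw [inter_insert]; exact le_inf hXS (A.mem_sub.1 hj'.1)
        · rw [hcd, Finset.card_insert_of_notMem hjS]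
      have hiff : A.IsNbc (insert j (insert a S)) ↔ A.IsNbc (insert j S) := by
        rw [Finset.insert_comm, isNbc_insert_iff hamin, hXeq]
        refine ⟨fun h => h.1, fun h => ⟨h, Finset.insert_comm j a S ▸ hind j hj, fun i hi => ?_⟩⟩
        exact hmin i (A.mem_sub.2 hi)
      have hjS' : j ∉ S := fun h => hjS (Finset.mem_insert_of_mem h)
      rw [flagTerm, flagTerm, hiff]
      by_cases hn : A.IsNbc (insert j S)
      · rw [if_pos ⟨hjS, hn⟩, if_pos ⟨hjS', hn⟩, insSign_insert haS haj, Finset.insert_comm,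
          flagForm_insert_min lam hamin, hXeq, mul_smul_comm, neg_smul]
      · rw [if_neg fun h => hn h.2, if_neg fun h => hn h.2, mul_zero, neg_zero]
    have hsub : A.sub (A.inter (insert a S)) ⊆ A.sub X := fun i hi =>
      A.mem_sub.2 (hXS.trans (A.mem_sub.1 hi))
    have hdiff : ∑ i ∈ A.sub X \ A.sub (A.inter (insert a S)),
          lam i • (A.om i * A.flagForm lam S) =
        A.omLamX lam X * A.flagForm lam S -
          A.omLamX lam (A.inter (insert a S)) * A.flagForm lam S := by
      rw [eq_sub_iff_add_eq, omLamX, omLamX, Finset.sum_mul, Finset.sum_mul]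
      simp only [smul_mul_assoc]
      exact Finset.sum_sdiff hsub
    rw [← sum_flagTerm_sdiff lam X hXS, Finset.sum_congr rfl hterm, Finset.sum_neg_distrib,
      ← Finset.mul_sum, ← hsumI, hdiff, mul_sub, ← mul_assoc, omLamX_mul_self, zero_mul, zero_sub,
      neg_neg, flagForm_insert_min lam ha]
where
  aux (S : Finset (Fin n)) (hS : A.IsNbc S) (X : AffineSubspace ℂ W)
      (hX : A.memL X) (hXS : X ≤ A.inter S) (hcd : A.cd X = S.card + 1)
      (hlt : ∀ b ∈ S, ∃ j ∈ A.sub X, j < b) :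
      A.omLamX lam X * A.flagForm lam S = ∑ j ∈ A.sub X, A.flagTerm lam S j := by
    have hne : (A.sub X).Nonempty := by
      rw [Finset.nonempty_iff_ne_empty]; intro h0
      have := A.inter_sub hX
      rw [h0, inter_empty] at this
      rw [← this, cd_amb] at hcd
      omega
    obtain ⟨m, hm, hmin⟩ : ∃ m ∈ A.sub X, ∀ j ∈ A.sub X, m ≤ j :=
      ⟨_, Finset.min'_mem _ hne, fun j hj => Finset.min'_le _ j hj⟩
    have hmS : ∀ b ∈ S, m < b := fun b hb => by
      obtain ⟨j, hj, hjb⟩ := hlt b hb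
      exact (hmin j hj).trans_lt hjb
    have hmn : m ∉ S := fun h => lt_irrefl _ (hmS m h)
    have hind : A.indep (insert m S) := by
      refine hS.1.insert (fun h0 => hX.1 (le_bot_iff.1 ?_)) fun h => ?_
      · rw [← h0, inter_insert]
        exact le_inf hXS (A.mem_sub.1 hm)
      · obtain ⟨b, hb, hbm⟩ := hS.exists_le h
        exact absurd hbm (not_le.2 (hmS b hb))
    have heq : ∀ j ∈ A.sub X, j ∉ S → A.indep (insert j S) → A.inter (insert j S) = X := by
      intro j hj hjS hjind
      refine inter_eq_of_indep hjind hX.1 ?_ ?_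
      · rw [inter_insert]; exact le_inf hXS (A.mem_sub.1 hj)
      · rw [hcd, Finset.card_insert_of_notMem hjS]
    have hmX := heq m hm hmn hind
    rw [Finset.sum_eq_single_of_mem m hm]
    · rw [flagTerm, if_pos, insSign_eq_one hmS, one_smul, flagForm_insert_min lam hmS, hmX]
      refine ⟨hmn, (isNbc_insert_iff hmS).2 ⟨hS, hind, fun i hi => hmin i ?_⟩⟩
      rw [hmX] at hi
      exact A.mem_sub.2 hi
    · intro j hj hjm
      rw [flagTerm, if_neg]
      rintro ⟨hjS, hn⟩
      obtain ⟨b, hb, hbm⟩ := hn.exists_le (i := m)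
        (by rw [heq j hj hjS hn.1]; exact A.mem_sub.1 hm)
      rcases Finset.mem_insert.1 hb with rfl | hb
      · exact hjm (le_antisymm hbm (hmin b hj))
      · exact absurd hbm (not_le.2 (hmS b hb))

/-- The expansion of `ω_λ Ξ(S)` for an nbc set `S`. -/
theorem omLam_mul_flagForm {S : Finset (Fin n)} (hS : A.IsNbc S) :
    A.omLam lam * A.flagForm lam S = ∑ j, A.flagTerm lam S j := by
  classical
  have h1 := sum_flagTerm_of_saturated lam
    (fun X h1 h2 h3 => omLamX_mul_flagForm lam hS X h1 h2 h3)
    (I := Finset.univ.filter fun i => i ∉ S ∧ A.indep (insert i S))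
    (fun i hi => (Finset.mem_filter.1 hi).2)
    (fun i hi j hj hjS => by
      refine Finset.mem_filter.2 ⟨Finset.mem_univ _, notMem_of_not_le hjS, ?_⟩
      refine hS.1.insert (fun h0 => (Finset.mem_filter.1 hi).2.2.1 (le_bot_iff.1 ?_)) hjS
      rw [← h0, A.inter_insert j]
      exact le_inf (A.inter_anti (Finset.subset_insert _ _)) hj)
  rw [← Finset.sum_subset (Finset.subset_univ
    (Finset.univ.filter fun i => i ∉ S ∧ A.indep (insert i S))) (f := A.flagTerm lam S), ← h1]
  · have h0 := omLamX_inter_mul_flagForm (A := A) lam S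
    rw [omLamX, Finset.sum_mul] at h0
    rw [omLam, Finset.sum_mul, ← Finset.sum_sdiff (Finset.subset_univ (A.sub (A.inter S))), h0,
      add_zero]
    simp only [smul_mul_assoc]
    symm
    refine Finset.sum_subset (fun i hi => ?_) fun i hi hi' => ?_
    · rw [Finset.mem_sdiff, mem_sub]
      obtain ⟨-, h1, h2⟩ := Finset.mem_filter.1 hi
      exact ⟨Finset.mem_univ _, h2.not_le h1⟩
    · rw [Finset.mem_sdiff, mem_sub] at hi
      rw [om_mul_flatPart_eq_zero (Y := A.inter S) _ (flagForm_mem_flatPart lam hS.1), smul_zero]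
      by_contra h0
      refine hi' (Finset.mem_filter.2 ⟨Finset.mem_univ _, notMem_of_not_le hi.2, ?_⟩)
      exact hS.1.insert (by rwa [inter_insert]) hi.2
  · intro j _ hj
    rw [flagTerm, if_neg]
    rintro ⟨h1, h2⟩
    exact hj (Finset.mem_filter.2 ⟨Finset.mem_univ _, h1, h2.1⟩)

end FlagForms

section Products

variable [FiniteDimensional ℂ W] {A : HArr W n} (lam : Fin n → ℂ)

lemma exists_eS_union {S T : Finset (Fin n)} (h : Disjoint S T) :
    ∃ c : ℂ, eS (S ∪ T) = c • (eS S * eS T) := by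
  induction S using Finset.induction_on with
  | empty => exact ⟨1, by rw [Finset.empty_union, eS_empty, one_mul, one_smul]⟩
  | insert i S hi ih =>
    rw [Finset.disjoint_insert_left] at h
    obtain ⟨c, hc⟩ := ih h.2
    have hiU : i ∉ S ∪ T := by simp [hi, h.1]
    refine ⟨insSign i (S ∪ T) * c * insSign i S, ?_⟩
    have h1 := gen_mul_eS hiU
    have h2 := gen_mul_eS hi
    calc eS (insert i S ∪ T) = insSign i (S ∪ T) • (gen i * eS (S ∪ T)) := by
          rw [h1, smul_smul, insSign_mul_self, one_smul, Finset.insert_union]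
      _ = (insSign i (S ∪ T) * c) • ((gen i * eS S) * eS T) := by
          rw [hc, mul_smul_comm, smul_smul, mul_assoc]
      _ = _ := by rw [h2, smul_mul_assoc, smul_smul]

lemma omLamX_mul_flagForm_comm (X : AffineSubspace ℂ W) (S : Finset (Fin n)) :
    ∃ c : ℂ, c ≠ 0 ∧
      A.omLamX lam X * A.flagForm lam S = c • (A.flagForm lam S * A.omLamX lam X) := by
  induction S using Finset.induction_on_min with
  | empty => exact ⟨1, one_ne_zero, by rw [flagForm_empty, mul_one, one_mul, one_smul]⟩
  | insert a S ha ih =>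
    obtain ⟨c, hc0, hc⟩ := ih
    refine ⟨-c, neg_ne_zero.2 hc0, ?_⟩
    rw [flagForm_insert_min lam ha, ← mul_assoc, omLamX_mul_swap, neg_mul, mul_assoc, hc,
      mul_smul_comm, neg_smul, mul_assoc]

lemma flagForm_mul_comm (S T : Finset (Fin n)) :
    ∃ c : ℂ, c ≠ 0 ∧
      A.flagForm lam S * A.flagForm lam T = c • (A.flagForm lam T * A.flagForm lam S) := by
  induction S using Finset.induction_on_min with
  | empty => exact ⟨1, one_ne_zero, by rw [flagForm_empty, mul_one, one_mul, one_smul]⟩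
  | insert a S ha ih =>
    obtain ⟨c, hc0, hc⟩ := ih
    obtain ⟨d, hd0, hd⟩ := omLamX_mul_flagForm_comm (A := A) lam (A.inter (insert a S)) T
    refine ⟨c * d, mul_ne_zero hc0 hd0, ?_⟩
    rw [flagForm_insert_min lam ha, mul_assoc, hc, mul_smul_comm, ← mul_assoc, hd, smul_mul_assoc,
      smul_smul, mul_assoc]

/-- A partition of the hyperplanes through `X` into two independent parts. -/
def IsSplit (A : HArr W n) (X : AffineSubspace ℂ W) (S T : Finset (Fin n)) : Prop :=
  X ≠ ⊥ ∧ X ≤ A.amb ∧ Disjoint S T ∧ S ∪ T = A.sub X ∧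
    ∀ I ⊆ S, ∀ J ⊆ T, A.indep I → A.indep J → A.indep (I ∪ J)

variable {X : AffineSubspace ℂ W} {S T : Finset (Fin n)}

lemma IsSplit.symm (h : A.IsSplit X S T) : A.IsSplit X T S :=
  ⟨h.1, h.2.1, h.2.2.1.symm, by rw [Finset.union_comm]; exact h.2.2.2.1,
    fun I hI J hJ h1 h2 => by rw [Finset.union_comm]; exact h.2.2.2.2 J hJ I hI h2 h1⟩

lemma IsSplit.le_inter (h : A.IsSplit X S T) {I : Finset (Fin n)} (hI : I ⊆ A.sub X) :
    X ≤ A.inter I :=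
  A.le_inter_iff.2 ⟨h.2.1, fun _ hi => A.mem_sub.1 (hI hi)⟩

lemma IsSplit.left_sub (h : A.IsSplit X S T) : S ⊆ A.sub X :=
  h.2.2.2.1 ▸ Finset.subset_union_left

lemma IsSplit.not_le_of_mem (h : A.IsSplit X S T) {I : Finset (Fin n)} (hI : I ⊆ S)
    (hind : A.indep I) {j : Fin n} (hj : j ∈ T) : ¬ A.inter I ≤ A.H j := by
  have h1 := h.2.2.2.2 I hI {j} (by simpa using hj) hind (indep_singleton j)
  rw [Finset.union_comm, ← Finset.insert_eq] at h1
  exact h1.not_le fun hjI => Finset.disjoint_left.1 h.2.2.1 (hI hjI) hj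

lemma IsSplit.le_left (h : A.IsSplit X S T) {I J : Finset (Fin n)} (hI : I ⊆ S) (hJ : J ⊆ T)
    (hIi : A.indep I) (hJi : A.indep J) {j : Fin n} (hj : j ∈ S)
    (hle : A.inter (I ∪ J) ≤ A.H j) : A.inter I ≤ A.H j := by
  by_contra hn
  have hsub : insert j I ⊆ S := Finset.insert_subset hj hI
  have hind : A.indep (insert j I) := by
    refine hIi.insert (fun h0 => h.1 (le_bot_iff.1 (h0 ▸ ?_))) hn
    exact h.le_inter (hsub.trans h.left_sub)
  have h1 := h.2.2.2.2 _ hsub J hJ hind hJi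
  rw [Finset.insert_union] at h1
  refine h1.not_le (fun hj' => ?_) hle
  rcases Finset.mem_union.1 hj' with hj' | hj'
  · exact notMem_of_not_le hn hj'
  · exact Finset.disjoint_left.1 h.2.2.1 hj (hJ hj')

lemma IsSplit.sub_inter_union (h : A.IsSplit X S T) {I J : Finset (Fin n)} (hI : I ⊆ S)
    (hJ : J ⊆ T) (hIi : A.indep I) (hJi : A.indep J) :
    Disjoint (A.sub (A.inter I)) (A.sub (A.inter J)) ∧
      A.sub (A.inter (I ∪ J)) = A.sub (A.inter I) ∪ A.sub (A.inter J) := by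
  have hmem : ∀ j, A.inter (I ∪ J) ≤ A.H j → j ∈ S ∨ j ∈ T := fun j hj => by
    rw [← Finset.mem_union, h.2.2.2.1, mem_sub]
    exact (h.le_inter (Finset.union_subset (hI.trans h.left_sub)
      (hJ.trans h.symm.left_sub))).trans hj
  have hl : A.inter (I ∪ J) ≤ A.inter I := A.inter_anti Finset.subset_union_left
  have hr : A.inter (I ∪ J) ≤ A.inter J := A.inter_anti Finset.subset_union_right
  refine ⟨Finset.disjoint_left.2 fun j h1 h2 => ?_, ?_⟩
  · rw [mem_sub] at h1 h2
    rcases hmem j (hl.trans h1) with hj | hj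
    · exact h.symm.not_le_of_mem hJ hJi hj h2
    · exact h.not_le_of_mem hI hIi hj h1
  · ext j
    rw [Finset.mem_union, mem_sub, mem_sub, mem_sub]
    refine ⟨fun hj => ?_, fun hj => hj.elim hl.trans hr.trans⟩
    rcases hmem j hj with hjS | hjT
    · exact Or.inl (h.le_left hI hJ hIi hJi hjS hj)
    · exact Or.inr (h.symm.le_left hJ hI hJi hIi hjT (by rwa [Finset.union_comm]))

lemma IsSplit.step (h : A.IsSplit X S T) {a : Fin n} {I J : Finset (Fin n)}
    (ha : ∀ b ∈ I ∪ J, a < b) (hI : insert a I ⊆ S) (hJ : J ⊆ T)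
    (hIn : A.IsNbc (insert a I)) (hJn : A.IsNbc J) (hU : A.IsNbc (I ∪ J))
    (hc : ∃ c : ℂ, c ≠ 0 ∧
      A.flagForm lam (I ∪ J) = c • (A.flagForm lam I * A.flagForm lam J)) :
    A.IsNbc (insert a I ∪ J) ∧ ∃ c : ℂ, c ≠ 0 ∧ A.flagForm lam (insert a I ∪ J) =
      c • (A.flagForm lam (insert a I) * A.flagForm lam J) := by
  obtain ⟨hdisj, hsub⟩ := h.sub_inter_union hI hJ hIn.1 hJn.1
  obtain ⟨c, hc0, hc⟩ := hc
  have haI : ∀ b ∈ I, a < b := fun b hb => ha b (Finset.mem_union_left _ hb)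
  constructor
  · rw [Finset.insert_union, isNbc_insert_iff ha]
    refine ⟨hU, Finset.insert_union a I J ▸ h.2.2.2.2 _ hI _ hJ hIn.1 hJn.1, fun i hi => ?_⟩
    rw [← mem_sub, ← Finset.insert_union, hsub, Finset.mem_union, mem_sub, mem_sub] at hi
    rcases hi with hi | hi
    · obtain ⟨b, hb, hbi⟩ := hIn.exists_le hi
      rcases Finset.mem_insert.1 hb with rfl | hb
      exacts [hbi, (haI b hb).le.trans hbi]
    · obtain ⟨b, hb, hbi⟩ := hJn.exists_le hi
      exact (ha b (Finset.mem_union_right _ hb)).le.trans hbi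
  · refine ⟨c, hc0, ?_⟩
    have hω : A.omLamX lam (A.inter (insert a I ∪ J)) =
        A.omLamX lam (A.inter (insert a I)) + A.omLamX lam (A.inter J) := by
      rw [omLamX, hsub, Finset.sum_union hdisj, omLamX, omLamX]
    obtain ⟨d, -, hd⟩ := omLamX_mul_flagForm_comm (A := A) lam (A.inter J) I
    have hz : A.omLamX lam (A.inter J) * (A.flagForm lam I * A.flagForm lam J) = 0 := by
      rw [← mul_assoc, hd, smul_mul_assoc, mul_assoc, omLamX_inter_mul_flagForm, mul_zero, smul_zero]
    rw [Finset.insert_union, flagForm_insert_min lam ha, ← Finset.insert_union, hc, hω, mul_smul_comm,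
      add_mul, hz, add_zero, flagForm_insert_min lam haI, mul_assoc]

lemma IsSplit.flagForm_union (h : A.IsSplit X S T) {I J : Finset (Fin n)} (hI : I ⊆ S)
    (hJ : J ⊆ T) (hIn : A.IsNbc I) (hJn : A.IsNbc J) :
    A.IsNbc (I ∪ J) ∧ ∃ c : ℂ, c ≠ 0 ∧ A.flagForm lam (I ∪ J) =
      c • (A.flagForm lam I * A.flagForm lam J) := by
  induction hk : I.card + J.card generalizing I J S T with
  | zero =>
    obtain rfl : I = ∅ := Finset.card_eq_zero.1 (by omega)
    obtain rfl : J = ∅ := Finset.card_eq_zero.1 (by omega)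
    refine ⟨by simpa using hIn, 1, one_ne_zero, ?_⟩
    rw [Finset.union_empty, flagForm_empty, one_smul, mul_one]
  | succ k ih =>
    have main : ∀ {S T I J : Finset (Fin n)}, A.IsSplit X S T → I ⊆ S → J ⊆ T → A.IsNbc I →
        A.IsNbc J → I.card + J.card = k + 1 → (∃ a ∈ I, ∀ b ∈ I ∪ J, a ≤ b) →
        A.IsNbc (I ∪ J) ∧ ∃ c : ℂ, c ≠ 0 ∧ A.flagForm lam (I ∪ J) =
          c • (A.flagForm lam I * A.flagForm lam J) := by
      rintro S T I J h hI hJ hIn hJn hk ⟨a, haI, ha⟩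
      obtain ⟨hU, hc⟩ := ih h ((Finset.erase_subset a I).trans hI) hJ
        (hIn.subset (Finset.erase_subset a I)) hJn
        (by rw [Finset.card_erase_of_mem haI]; have := Finset.card_pos.2 ⟨a, haI⟩; omega)
      have haJ : a ∉ J := fun haJ => Finset.disjoint_left.1 h.2.2.1 (hI haI) (hJ haJ)
      have := h.step lam (a := a) (I := I.erase a) (J := J) (fun b hb => ?_)
        (by rwa [Finset.insert_erase haI]) hJ (by rwa [Finset.insert_erase haI]) hJn hU hc
      · rwa [Finset.insert_erase haI] at this
      · rcases Finset.mem_union.1 hb with hb' | hb'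
        · rw [Finset.mem_erase] at hb'
          exact lt_of_le_of_ne (ha b (Finset.mem_union_left _ hb'.2)) (Ne.symm hb'.1)
        · exact lt_of_le_of_ne (ha b (Finset.mem_union_right _ hb'))
            fun h0 => haJ (h0 ▸ hb')
    have hne : (I ∪ J).Nonempty := by
      rw [Finset.nonempty_iff_ne_empty]; intro h0
      rw [Finset.union_eq_empty] at h0
      rw [h0.1, h0.2] at hk; simp at hk
    have hmin : ∀ b ∈ I ∪ J, (I ∪ J).min' hne ≤ b := fun b hb => Finset.min'_le _ b hb
    rcases Finset.mem_union.1 ((I ∪ J).min'_mem hne) with hm | hm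
    · exact main h hI hJ hIn hJn hk ⟨_, hm, hmin⟩
    · obtain ⟨h1, c, hc0, hc⟩ := main h.symm hJ hI hJn hIn (by omega)
        ⟨_, hm, fun b hb => hmin b (by rwa [Finset.union_comm])⟩
      obtain ⟨d, hd0, hd⟩ := flagForm_mul_comm (A := A) lam J I
      refine ⟨by rwa [Finset.union_comm], c * d, mul_ne_zero hc0 hd0, ?_⟩
      rw [Finset.union_comm, hc, hd, smul_smul]

/-- The span of the flag forms of the nbc sets with intersection `X`. -/
def flagSpan (A : HArr W n) (lam : Fin n → ℂ) (X : AffineSubspace ℂ W) : Submodule ℂ (OS A) :=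
  Submodule.span ℂ {x | ∃ B, A.IsNbc B ∧ A.inter B = X ∧ x = A.flagForm lam B}

lemma omLamX_mul_mem_flagSpan {X Y : AffineSubspace ℂ W} (hX : A.memL X) (hXY : X ≤ Y)
    (hcd : A.cd X = A.cd Y + 1) {y : OS A} (hy : y ∈ A.flagSpan lam Y) :
    A.omLamX lam X * y ∈ A.flagSpan lam X := by
  refine Submodule.span_induction (p := fun y _ => A.omLamX lam X * y ∈ A.flagSpan lam X)
    ?_ ?_ ?_ ?_ hy
  · rintro _ ⟨B, hB, rfl, rfl⟩
    have hcd' : A.cd X = B.card + 1 := by rw [hcd, hB.1.2]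
    rw [omLamX_mul_flagForm lam hB X hX hXY hcd']
    refine Submodule.sum_mem _ fun j hj => ?_
    rw [flagTerm]
    split_ifs with h
    · refine Submodule.smul_mem _ _ (Submodule.subset_span ⟨_, h.2, ?_, rfl⟩)
      refine inter_eq_of_indep h.2.1 hX.1 ?_ ?_
      · rw [inter_insert]; exact le_inf hXY (A.mem_sub.1 hj)
      · rw [hcd', Finset.card_insert_of_notMem h.1]
    · exact zero_mem _
  · rw [mul_zero]; exact zero_mem _
  · intro x y _ _ hx hy; rw [mul_add]; exact add_mem hx hy
  · intro c x _ hx; rw [mul_smul_comm]; exact Submodule.smul_mem _ _ hx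

lemma IsSplit.mul_mem_flagSpan (h : A.IsSplit X S T) (hS : A.sub (A.inter S) = S)
    (hT : A.sub (A.inter T) = T) (hX : A.inter S ⊓ A.inter T = X) {x y : OS A}
    (hx : x ∈ A.flagSpan lam (A.inter S)) (hy : y ∈ A.flagSpan lam (A.inter T)) :
    x * y ∈ A.flagSpan lam X := by
  refine Submodule.mul_le (P := A.flagSpan lam X) |>.1 ?_ x hx y hy
  rw [flagSpan, flagSpan, Submodule.span_mul_span, Submodule.span_le]
  rintro _ ⟨_, ⟨B, hB, hBS, rfl⟩, _, ⟨C, hC, hCT, rfl⟩, rfl⟩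
  have hBS' : B ⊆ S := fun b hb => by rw [← hS, mem_sub, ← hBS]; exact A.inter_le_H hb
  have hCT' : C ⊆ T := fun b hb => by rw [← hT, mem_sub, ← hCT]; exact A.inter_le_H hb
  obtain ⟨hn, c, hc0, hc⟩ := h.flagForm_union lam hBS' hCT' hB hC
  have : A.flagForm lam B * A.flagForm lam C = c⁻¹ • A.flagForm lam (B ∪ C) := by
    rw [hc, smul_smul, inv_mul_cancel₀ hc0, one_smul]
  simp only [this]
  refine Submodule.smul_mem _ _ (Submodule.subset_span ⟨_, hn, ?_, rfl⟩)
  rw [inter_union, hBS, hCT, hX]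

/-- A non-dense flat is split. -/
lemma isSplit_of_cd_add (hX : A.memL X) (hdisj : Disjoint S T) (hST : S ∪ T = A.sub X)
    (hcd : A.cd (A.inter S) + A.cd (A.inter T) = A.cd X) : A.IsSplit X S T := by
  have hamb : X ≤ A.amb := by obtain ⟨-, U, rfl⟩ := hX; exact A.inter_le_amb U
  have hne : ∀ U ⊆ A.sub X, A.inter U ≠ ⊥ := fun U hU =>
    A.inter_ne_bot_of_subset hU (by rw [A.inter_sub hX]; exact hX.1)
  refine ⟨hX.1, hamb, hdisj, hST, fun I hI J hJ hIi hJi => ?_⟩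
  obtain ⟨I', hI', hII', hI'S, hI'e⟩ :=
    exists_indep_superset hIi hI (hne _ (hST ▸ Finset.subset_union_left))
  obtain ⟨J', hJ', hJJ', hJ'T, hJ'e⟩ :=
    exists_indep_superset hJi hJ (hne _ (hST ▸ Finset.subset_union_right))
  have h1 : A.inter (I' ∪ J') = X := by
    rw [inter_union, hI'e, hJ'e, ← inter_union, hST, A.inter_sub hX]
  have h2 : A.indep (I' ∪ J') := by
    refine ⟨h1 ▸ hX.1, ?_⟩
    rw [h1, Finset.card_union_of_disjoint (Finset.disjoint_of_subset_left hI'S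
      (Finset.disjoint_of_subset_right hJ'T hdisj)), ← hI'.2, ← hJ'.2, hI'e, hJ'e, hcd]
  exact h2.subset (Finset.union_subset_union hII' hJJ')

lemma IsSplit.sub_left (h : A.IsSplit X S T) : A.sub (A.inter S) = S := by
  ext j
  rw [mem_sub]
  refine ⟨fun hj => ?_, A.inter_le_H⟩
  have hSne : A.inter S ≠ ⊥ := fun h0 => h.1 (le_bot_iff.1 (h0 ▸ h.le_inter h.left_sub))
  obtain ⟨I, hI, -, hIS, hIe⟩ := exists_indep_superset indep_empty (Finset.empty_subset S) hSne
  have hjX : j ∈ S ∪ T := by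
    rw [h.2.2.2.1, mem_sub]; exact (h.le_inter h.left_sub).trans hj
  rcases Finset.mem_union.1 hjX with hj' | hj'
  · exact hj'
  · exact absurd (hIe ▸ hj) (h.not_le_of_mem hIS hI hj')

lemma cd_pos {U : Finset (Fin n)} (hU : U.Nonempty) (hne : A.inter U ≠ ⊥) :
    0 < A.cd (A.inter U) := by
  obtain ⟨i, hi⟩ := hU
  by_contra! h
  have := A.eq_of_le_of_cd_le hne (A.inter_le_amb U) le_rfl (by omega)
  exact A.not_amb_le i (this ▸ A.inter_le_H hi)

/-- If `λ` is nonzero on the dense flats, flag forms span. -/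
theorem flatPart_le_flagSpan
    (hlam : ∀ X, A.memL X → X ≠ A.amb → A.denseL X → A.lamX lam X ≠ 0)
    (X : AffineSubspace ℂ W) (hX : A.memL X) : A.flatPart X ≤ A.flagSpan lam X := by
  classical
  induction hk : A.cd X using Nat.strong_induction_on generalizing X with
  | _ k ih =>
  rw [flatPart, Submodule.span_le]
  rintro _ ⟨S, hS, rfl, rfl⟩
  by_cases hamb : A.inter S = A.amb
  · have h0 : S = ∅ := by
      rw [← Finset.card_eq_zero, ← hS.2, hamb, cd_amb]
    subst h0
    exact Submodule.subset_span ⟨∅, isNbc_empty, rfl, by rw [flagForm_empty, omB, eS_empty, map_one]⟩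
  by_cases hd : A.denseL (A.inter S)
  · have hl := hlam _ hX hamb hd
    have h1 : A.omB S = (A.lamX lam (A.inter S))⁻¹ •
        (A.omLamX lam (A.inter S) * osMk A (bdry S)) := by
      rw [← lamX_smul_omB lam S hS.1, smul_smul, inv_mul_cancel₀ hl, one_smul]
    rw [h1]
    refine Submodule.smul_mem _ _ ?_
    rw [bdry, map_sum, Finset.mul_sum]
    refine Submodule.sum_mem _ fun i hi => ?_
    rw [map_smul, mul_smul_comm]
    refine Submodule.smul_mem _ _ ?_
    have hind := hS.subset (Finset.erase_subset i S)
    have hcd : A.cd (A.inter S) = A.cd (A.inter (S.erase i)) + 1 := by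
      rw [hS.2, hind.2, Finset.card_erase_add_one hi]
    refine omLamX_mul_mem_flagSpan lam hX (A.inter_anti (Finset.erase_subset i S)) hcd ?_
    exact ih _ (by omega) _ ⟨hind.1, _, rfl⟩ rfl (Submodule.subset_span ⟨_, hind, rfl, rfl⟩)
  · rw [denseL, not_not] at hd
    obtain ⟨P, Q, hdisj, hP, hQ, hPQ, hcd⟩ := hd
    have hsp := isSplit_of_cd_add hX hdisj hPQ hcd
    have hPle := hsp.le_inter hsp.left_sub
    have hQle := hsp.le_inter hsp.symm.left_sub
    have hPne : A.inter P ≠ ⊥ := fun h0 => hX.1 (le_bot_iff.1 (h0 ▸ hPle))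
    have hQne : A.inter Q ≠ ⊥ := fun h0 => hX.1 (le_bot_iff.1 (h0 ▸ hQle))
    have hSsub : S ⊆ P ∪ Q := fun i hi => by rw [hPQ, mem_sub]; exact A.inter_le_H hi
    have hSeq : (S ∩ P) ∪ (S ∩ Q) = S := by
      rw [← Finset.inter_union_distrib_left, Finset.inter_eq_left.2 hSsub]
    have hdis : Disjoint (S ∩ P) (S ∩ Q) := Finset.disjoint_of_subset_left
      Finset.inter_subset_right (Finset.disjoint_of_subset_right Finset.inter_subset_right hdisj)
    have hcard := Finset.card_union_of_disjoint hdis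
    rw [hSeq, ← hS.2, ← hcd] at hcard
    have hSP := hS.subset (Finset.inter_subset_left (s₁ := S) (s₂ := P))
    have hSQ := hS.subset (Finset.inter_subset_left (s₁ := S) (s₂ := Q))
    have hP1 : A.inter P ≤ A.inter (S ∩ P) := A.inter_anti Finset.inter_subset_right
    have hQ1 : A.inter Q ≤ A.inter (S ∩ Q) := A.inter_anti Finset.inter_subset_right
    have hPc := A.cd_anti hP1
    have hQc := A.cd_anti hQ1
    rw [hSP.2] at hPc
    rw [hSQ.2] at hQc
    have hPe := inter_eq_of_indep hSP hPne hP1 (by omega)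
    have hQe := inter_eq_of_indep hSQ hQne hQ1 (by omega)
    have hP0 := cd_pos hP hPne
    have hQ0 := cd_pos hQ hQne
    obtain ⟨c, hc⟩ := exists_eS_union hdis
    rw [hSeq] at hc
    have hom : A.omB S = c • (A.omB (S ∩ P) * A.omB (S ∩ Q)) := by
      rw [omB, hc, map_smul, map_mul, omB, omB]
    rw [hom]
    refine Submodule.smul_mem _ _ (hsp.mul_mem_flagSpan lam hsp.sub_left hsp.symm.sub_left ?_ ?_ ?_)
    · rw [← inter_union, hPQ, A.inter_sub hX]
    · exact ih _ (by omega) _ ⟨hPne, _, rfl⟩ rfl (Submodule.subset_span ⟨_, hSP, hPe, rfl⟩)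
    · exact ih _ (by omega) _ ⟨hQne, _, rfl⟩ rfl (Submodule.subset_span ⟨_, hSQ, hQe, rfl⟩)

end Products

section Descent

variable [FiniteDimensional ℂ W] {A : HArr W n} (lam : Fin n → ℂ)

/-- The member `i` of the base `B` can be exchanged for a smaller index. -/
def Movable (A : HArr W n) (B : Finset (Fin n)) (i : Fin n) : Prop :=
  ∃ j, j < i ∧ A.isBase (insert j (B.erase i))

lemma isBase.toColex_lt {B B' T : Finset (Fin n)} (hB : A.isBase B) (hB' : A.isBase B')
    (hT : T ⊆ B') (hmov : ∀ i ∈ B, i ∉ T → ¬ A.Movable B i) (hne : B ≠ B') :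
    toColex B < toColex B' := by
  rw [Finset.Colex.toColex_lt_toColex_iff_max'_mem]
  refine ⟨hne, ?_⟩
  set x := (symmDiff B B').max' (Finset.symmDiff_nonempty.2 hne) with hx
  have hmem : x ∈ symmDiff B B' := Finset.max'_mem _ _
  have hmax : ∀ y ∈ symmDiff B B', y ≤ x := fun y hy => Finset.le_max' _ y hy
  by_contra hxB'
  have hxB : x ∈ B := by
    rcases Finset.mem_symmDiff.1 hmem with h | h
    exacts [h.1, absurd h.1 hxB']
  refine hmov x hxB (fun h => hxB' (hT h)) ?_
  obtain ⟨j, hj, hjB, hbase⟩ := hB.exchange hB' hxB hxB'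
  refine ⟨j, lt_of_le_of_ne (hmax j (Finset.mem_symmDiff.2 (Or.inr ⟨hj, hjB⟩))) ?_, hbase⟩
  rintro rfl
  exact hjB hxB

lemma IsNbc.exists_insert {S : Finset (Fin n)} (hS : A.IsNbc S) (hcard : S.card + 1 = A.rank) :
    ∃ k, k ∉ S ∧ A.IsNbc (insert k S) ∧ A.isBase (insert k S) ∧ ¬ A.Movable (insert k S) k := by
  classical
  obtain ⟨I, hI, hIr⟩ := A.exists_indep_card_eq_rank
  obtain ⟨k₀, -, hk₀, hk₀i⟩ := hS.1.augment hI (by omega)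
  obtain ⟨k, hk, hmin⟩ := Finset.exists_min_image
    (Finset.univ.filter fun k => k ∉ S ∧ A.indep (insert k S)) id ⟨k₀, by simp [hk₀, hk₀i]⟩
  simp only [Finset.mem_filter, Finset.mem_univ, true_and, id] at hk hmin
  obtain ⟨hkS, hkind⟩ := hk
  refine ⟨k, hkS, ⟨hkind, ?_⟩, isBase_iff.2 ⟨hkind, ?_⟩, ?_⟩
  · intro b hb i hi
    by_contra! hib
    rcases lt_or_ge k b with hkb | hbk
    · rw [Finset.filter_insert, if_neg (not_le.2 hkb)] at hi
      have hbS : b ∈ S := (Finset.mem_insert.1 hb).resolve_left hkb.ne'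
      exact absurd (hS.2 b hbS i hi) (not_le.2 hib)
    rw [Finset.filter_insert, if_pos hbk] at hi
    set T := S.filter (b ≤ ·) with hT
    have hTS : T ⊆ S := Finset.filter_subset _ _
    have hkT : k ∉ T := fun h => hkS (hTS h)
    have hnT : ¬ A.inter T ≤ A.H i := fun h => by
      obtain ⟨b', hb', hb'i⟩ := (hS.subset hTS).exists_le h
      exact absurd ((Finset.mem_filter.1 hb').2.trans hb'i) (not_le.2 hib)
    have hTk := hkind.subset (Finset.insert_subset_insert k hTS)
    have hiT := notMem_of_not_le hnT
    have hTi : A.indep (insert i T) := by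
      refine (hS.1.subset hTS).insert (fun h0 => hTk.1 (le_bot_iff.1 ?_)) hnT
      rw [← h0, A.inter_insert i]
      exact le_inf (A.inter_anti (Finset.subset_insert _ _)) hi
    have heq := inter_insert_eq_of_le hTk hTi hkT hiT hi
    by_cases hSi : A.inter S ≤ A.H i
    · refine hkind.not_le hkS (le_trans ?_ (heq ▸ A.inter_le_H (Finset.mem_insert_self k T)))
      rw [inter_insert]
      exact le_inf (A.inter_anti hTS) hSi
    · refine absurd (hmin i ⟨notMem_of_not_le hSi, ?_⟩) (not_le.2 (hib.trans_le hbk))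
      refine hS.1.insert (fun h0 => hkind.1 (le_bot_iff.1 ?_)) hSi
      rw [← h0, A.inter_insert i]
      exact le_inf (A.inter_anti (Finset.subset_insert _ _))
        ((A.inter_anti (Finset.insert_subset_insert k hTS)).trans hi)
  · rw [Finset.card_insert_of_notMem hkS, hcard]
  · rintro ⟨j, hjk, hj⟩
    rw [Finset.erase_insert hkS, isBase_iff] at hj
    have hjS : j ∉ S := fun h => by
      rw [Finset.insert_eq_of_mem h] at hj; omega
    exact absurd (hmin j ⟨hjS, hj.1⟩) (not_le.2 hjk)

lemma IsNbc.isBase_of_card {S : Finset (Fin n)} (hS : A.IsNbc S) (h : S.card = A.rank) :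
    A.isBase S := isBase_iff.2 ⟨hS.1, h⟩

lemma flagTerm_of_isNbc {S : Finset (Fin n)} {j : Fin n} (hj : j ∉ S)
    (h : A.IsNbc (insert j S)) :
    A.flagTerm lam S j = insSign j S • A.flagForm lam (insert j S) := by
  rw [flagTerm, if_pos ⟨hj, h⟩]

/-- If `i ∈ B` is not movable, then `Ξ(B)` is, modulo `ω_λ Ξ(B ∖ i)`, a combination of flag forms
of colexicographically larger bases. -/
lemma IsNbc.flagForm_mem_of_not_movable {B : Finset (Fin n)} (hB : A.IsNbc B) (hb : A.isBase B)
    {i : Fin n} (hi : i ∈ B) (hmov : ¬ A.Movable B i) {N : Submodule ℂ (OS A)}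
    (h1 : A.omLam lam * A.flagForm lam (B.erase i) ∈ N)
    (h2 : ∀ B', A.IsNbc B' → A.isBase B' → toColex B < toColex B' → A.flagForm lam B' ∈ N) :
    A.flagForm lam B ∈ N := by
  classical
  have hS := hB.subset (Finset.erase_subset i B)
  have hiS : i ∉ B.erase i := Finset.notMem_erase i B
  have hins : insert i (B.erase i) = B := Finset.insert_erase hi
  rw [omLam_mul_flagForm lam hS, ← Finset.add_sum_erase _ _ (Finset.mem_univ i),
    flagTerm_of_isNbc lam hiS (hins.symm ▸ hB), hins] at h1
  have h3 : ∑ j ∈ Finset.univ.erase i, A.flagTerm lam (B.erase i) j ∈ N := by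
    refine Submodule.sum_mem _ fun j hj => ?_
    rw [flagTerm]
    split_ifs with h
    · refine Submodule.smul_mem _ _ ?_
      have hcard : (insert j (B.erase i)).card = A.rank := by
        rw [Finset.card_insert_of_notMem h.1, Finset.card_erase_add_one hi, (isBase_iff.1 hb).2]
      have hbase := h.2.isBase_of_card hcard
      refine h2 _ h.2 hbase (hb.toColex_lt hbase (Finset.subset_insert _ _) ?_ ?_)
      · intro x hx hx'
        obtain rfl : x = i := by
          by_contra hne; exact hx' (Finset.mem_erase.2 ⟨hne, hx⟩)
        exact hmov
      · intro heq
        have hjB : j ∈ B := heq ▸ Finset.mem_insert_self _ _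
        exact h.1 (Finset.mem_erase.2 ⟨(Finset.mem_erase.1 hj).1, hjB⟩)
    · exact zero_mem _
  have h4 := (Submodule.add_mem_iff_left N h3).1 h1
  exact (Submodule.smul_mem_iff N (insSign_ne_zero _ _)).1 h4

/-- The products `ω_λ Ξ(S)` with `S` an nbc set of corank one are generated by those for
`S = B ∖ {i}`, where one non-movable element `i` is chosen for each nbc-base `B`. -/
theorem omLam_mul_flagForm_mem {N : Submodule ℂ (OS A)}
    (hN : ∀ B, A.IsNbc B → A.isBase B → (∃ i ∈ B, ¬ A.Movable B i) →
      ∃ i ∈ B, ¬ A.Movable B i ∧ A.omLam lam * A.flagForm lam (B.erase i) ∈ N)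
    {S : Finset (Fin n)} (hS : A.IsNbc S) (hcard : S.card + 1 = A.rank) :
    A.omLam lam * A.flagForm lam S ∈ N := by
  classical
  suffices key : ∀ C : Colex (Finset (Fin n)), ∀ S k, k ∉ S → C = toColex (insert k S) →
      A.IsNbc S → A.IsNbc (insert k S) → A.isBase (insert k S) → ¬ A.Movable (insert k S) k →
      A.omLam lam * A.flagForm lam S ∈ N by
    obtain ⟨k, hk, h1, h2, h3⟩ := hS.exists_insert hcard
    exact key _ S k hk rfl hS h1 h2 h3
  clear hS hcard S
  intro C
  have : Finite (Colex (Finset (Fin n))) := Finite.of_injective ofColex ofColex.injective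
  induction C using WellFoundedGT.induction with
  | ind C ih =>
  rintro S k hkS rfl hS hBn hB hkm
  obtain ⟨i, hiB, him, hiN⟩ := hN _ hBn hB ⟨k, Finset.mem_insert_self _ _, hkm⟩
  by_cases hik : i = k
  · rwa [hik, Finset.erase_insert hkS] at hiN
  have hiS : i ∈ S := (Finset.mem_insert.1 hiB).resolve_left hik
  have hkT : k ∉ S.erase i := fun h => hkS (Finset.mem_of_mem_erase h)
  have hiT : i ∉ S.erase i := Finset.notMem_erase i S
  have hT := hS.subset (Finset.erase_subset i S)
  have hcard : S.card + 1 = A.rank := by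
    rw [← (isBase_iff.1 hB).2, Finset.card_insert_of_notMem hkS]
  have hSi : insert i (S.erase i) = S := Finset.insert_erase hiS
  have hBk : insert k (S.erase i) = (insert k S).erase i :=
    (Finset.erase_insert_of_ne (Ne.symm hik)).symm
  have h0 : A.omLam lam * (A.omLam lam * A.flagForm lam (S.erase i)) = 0 := by
    rw [← mul_assoc, omLam_mul_self, zero_mul]
  have hrest : ∀ j ∈ Finset.univ.erase i, A.omLam lam * A.flagTerm lam (S.erase i) j ∈ N := by
    intro j hj
    have hji := (Finset.mem_erase.1 hj).1
    rw [flagTerm]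
    split_ifs with h
    · rw [mul_smul_comm]
      refine Submodule.smul_mem _ _ ?_
      by_cases hjk : j = k
      · rw [hjk, hBk]; exact hiN
      obtain ⟨hjT, hn⟩ := h
      have hjc : (insert j (S.erase i)).card + 1 = A.rank := by
        rw [Finset.card_insert_of_notMem hjT, Finset.card_erase_add_one hiS, hcard]
      obtain ⟨l, hl, hl1, hl2, hl3⟩ := hn.exists_insert hjc
      refine ih _ ?_ _ l hl rfl hn hl1 hl2 hl3
      refine hB.toColex_lt hl2 (T := S.erase i) ?_ ?_ ?_
      · exact (Finset.subset_insert _ _).trans (Finset.subset_insert _ _)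
      · intro x hx hxT
        rcases Finset.mem_insert.1 hx with rfl | hx
        · exact hkm
        · obtain rfl : x = i := by
            by_contra hne; exact hxT (Finset.mem_erase.2 ⟨hne, hx⟩)
          exact him
      · intro heq
        have hjB : j ∈ insert k S :=
          heq ▸ Finset.mem_insert_of_mem (Finset.mem_insert_self _ _)
        exact hjT (Finset.mem_erase.2 ⟨hji, (Finset.mem_insert.1 hjB).resolve_left hjk⟩)
    · rw [mul_zero]; exact zero_mem _
  rw [omLam_mul_flagForm lam hT, Finset.mul_sum, ← Finset.add_sum_erase _ _ (Finset.mem_univ i),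
    flagTerm_of_isNbc lam hiT (hSi.symm ▸ hS), hSi, mul_smul_comm] at h0
  have h1 := neg_mem (Submodule.sum_mem N hrest)
  rw [← eq_neg_of_add_eq_zero_left h0] at h1
  exact (Submodule.smul_mem_iff N (insSign_ne_zero _ _)).1 h1

end Descent

section Assembly

variable [FiniteDimensional ℂ W] {A : HArr W n} (lam : Fin n → ℂ)

lemma betaNbcBase_one_iff {S : Finset (Fin n)} :
    A.betaNbcBase 1 S ↔ (A.IsNbc S ∧ A.isBase S) ∧ ∀ i ∈ S, A.Movable S i := by
  rw [betaNbcBase, nbcBase, nbcSet_iff]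
  rfl

lemma isBase.maximalL {B : Finset (Fin n)} (hB : A.isBase B) : A.maximalL (A.inter B) := by
  refine ⟨⟨hB.1.1, B, rfl⟩, ?_⟩
  rintro _ ⟨hne, T, rfl⟩ hle
  obtain ⟨I, hI, -, -, hIT⟩ := exists_indep_superset indep_empty (Finset.empty_subset T) hne
  refine A.eq_of_le_of_cd_le hne hle (A.inter_le_amb B) ?_
  rw [← hIT, hI.2, hB.1.2, (isBase_iff.1 hB).2]
  exact hI.card_le_rank

lemma IsNbc.isBase_of_inter_eq {B B' : Finset (Fin n)} (hB : A.isBase B) (hB' : A.IsNbc B')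
    (h : A.inter B' = A.inter B) : A.isBase B' :=
  hB'.isBase_of_card (by rw [← hB'.1.2, h, hB.1.2, (isBase_iff.1 hB).2])

/-- On a maximal flat, the flag forms lie in the span of the nbc monomials. -/
lemma flatPart_le_span_nbc
    (hlam : ∀ X, A.memL X → X ≠ A.amb → A.denseL X → A.lamX lam X ≠ 0)
    {B : Finset (Fin n)} (hB : A.isBase B) :
    A.flatPart (A.inter B) ≤
      Submodule.span ℂ {x | ∃ T, A.IsNbc T ∧ A.inter T = A.inter B ∧ x = A.omB T} := by
  classical
  let J := {T : Finset (Fin n) // A.IsNbc T ∧ A.inter T = A.inter B}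
  have hle := flatPart_le_flagSpan lam hlam _ hB.maximalL.1
  have h1 : A.flagSpan lam (A.inter B) =
      Submodule.span ℂ (Set.range fun T : J => A.flagForm lam T.1) := by
    rw [flagSpan]
    congr 1
    ext x
    constructor
    · rintro ⟨T, hT, hTX, rfl⟩; exact ⟨⟨T, hT, hTX⟩, rfl⟩
    · rintro ⟨T, rfl⟩; exact ⟨T.1, T.2.1, T.2.2, rfl⟩
  have h2 : {x | ∃ T, A.IsNbc T ∧ A.inter T = A.inter B ∧ x = A.omB T} =
      Set.range fun T : J => A.omB T.1 := by
    ext x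
    constructor
    · rintro ⟨T, hT, hTX, rfl⟩; exact ⟨⟨T, hT, hTX⟩, rfl⟩
    · rintro ⟨T, rfl⟩; exact ⟨T.1, T.2.1, T.2.2, rfl⟩
  have hli : LinearIndependent ℂ fun T : J => A.omB T.1 :=
    (linearIndependent_nbc (A := A)).comp
      (fun T : J => ⟨T.1, T.2.1, T.2.1.isBase_of_inter_eq hB T.2.2⟩)
      fun T T' h => Subtype.ext (congrArg (fun x => x.1) h)
  rw [h1] at hle
  rw [h2]
  have hfd : FiniteDimensional ℂ
      (Submodule.span ℂ (Set.range fun T : J => A.flagForm lam T.1)) :=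
    FiniteDimensional.span_of_finite ℂ (Set.finite_range _)
  have hfd' : FiniteDimensional ℂ (A.flatPart (A.inter B)) :=
    Submodule.finiteDimensional_of_le hle
  refine (Submodule.eq_of_le_of_finrank_le ?_ ?_).ge
  · rw [Submodule.span_le]
    rintro _ ⟨T, rfl⟩
    exact Submodule.subset_span ⟨T.1, T.2.1.1, T.2.2, rfl⟩
  · rw [finrank_span_eq_card hli]
    exact (Submodule.finrank_mono hle).trans (finrank_range_le_card _)

open scoped Classical in
/-- The form attached to an nbc-base `B`: the monomial `ω_B` when every element of `B` is
movable, and otherwise the product `ω_λ Ξ(B ∖ {i})` for a chosen non-movable `i`. -/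
def mixedForm (A : HArr W n) (lam : Fin n → ℂ) (B : Finset (Fin n)) : OS A :=
  if h : ∃ i ∈ B, ¬ A.Movable B i then A.omLam lam * A.flagForm lam (B.erase h.choose)
  else A.omB B

lemma mixedForm_of_movable {B : Finset (Fin n)} (h : ∀ i ∈ B, A.Movable B i) :
    A.mixedForm lam B = A.omB B :=
  dif_neg (by push Not; exact h)

lemma exists_mixedForm_eq {B : Finset (Fin n)} (h : ¬ ∀ i ∈ B, A.Movable B i) :
    ∃ i ∈ B, ¬ A.Movable B i ∧
      A.mixedForm lam B = A.omLam lam * A.flagForm lam (B.erase i) := by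
  have h' : ∃ i ∈ B, ¬ A.Movable B i := by push Not at h; exact h
  exact ⟨h'.choose, h'.choose_spec.1, h'.choose_spec.2, dif_pos h'⟩

variable {lam}

/-- Flag forms of nbc-bases lie in the span of the mixed forms. -/
lemma flagForm_mem_span_mixedForm (hunmixed : A.unmixedOrd 1)
    (hlam : ∀ X, A.memL X → X ≠ A.amb → A.denseL X → A.lamX lam X ≠ 0)
    {B : Finset (Fin n)} (hn : A.IsNbc B) (hb : A.isBase B) :
    A.flagForm lam B ∈ Submodule.span ℂ
      (Set.range fun B : {B : Finset (Fin n) // A.IsNbc B ∧ A.isBase B} =>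
        A.mixedForm lam B.1) := by
  classical
  suffices key : ∀ C : Colex (Finset (Fin n)), ∀ B, C = toColex B → A.IsNbc B → A.isBase B →
      A.flagForm lam B ∈ Submodule.span ℂ
        (Set.range fun B : {B : Finset (Fin n) // A.IsNbc B ∧ A.isBase B} =>
          A.mixedForm lam B.1) from key _ B rfl hn hb
  clear hn hb B
  intro C
  have : Finite (Colex (Finset (Fin n))) := Finite.of_injective ofColex ofColex.injective
  induction C using WellFoundedGT.induction with
  | ind C ih =>
  intro B hC hn hb
  by_cases hfull : ∀ i ∈ B, A.Movable B i
  · have hall : ∀ T, A.IsNbc T → A.inter T = A.inter B → ∀ i ∈ T, A.Movable T i := by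
      intro T hT hTB
      have hTb := hT.isBase_of_inter_eq hb hTB
      rcases hunmixed _ hb.maximalL with h | h
      · exact (betaNbcBase_one_iff.1 (h T ⟨nbcSet_iff.2 hT, hTb⟩ hTB)).2
      · exact absurd (betaNbcBase_one_iff.2 ⟨⟨hn, hb⟩, hfull⟩) (h B ⟨nbcSet_iff.2 hn, hb⟩ rfl)
    refine Submodule.span_le.2 ?_
      (flatPart_le_span_nbc lam hlam hb (flagForm_mem_flatPart lam hn.1))
    rintro _ ⟨T, hT, hTB, rfl⟩
    refine Submodule.subset_span ⟨⟨T, hT, hT.isBase_of_inter_eq hb hTB⟩, ?_⟩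
    exact mixedForm_of_movable lam (hall T hT hTB)
  · obtain ⟨i, h1, h2, h3⟩ := exists_mixedForm_eq lam hfull
    refine hn.flagForm_mem_of_not_movable lam hb h1 h2 ?_
      fun B' hn' hb' hlt => ih _ (hC ▸ hlt) B' rfl hn' hb'
    exact Submodule.subset_span ⟨⟨B, hn, hb⟩, h3⟩

lemma omB_mem_span_flagForm
    (hlam : ∀ X, A.memL X → X ≠ A.amb → A.denseL X → A.lamX lam X ≠ 0) (S : Finset (Fin n)) :
    A.omB S ∈ Submodule.span ℂ
      {x | ∃ T, A.IsNbc T ∧ T.card = S.card ∧ x = A.flagForm lam T} := by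
  by_cases hS : A.indep S
  · have h := flatPart_le_flagSpan lam hlam (A.inter S) ⟨hS.1, S, rfl⟩
      (Submodule.subset_span ⟨S, hS, rfl, rfl⟩)
    refine Submodule.span_mono ?_ h
    rintro _ ⟨T, hT, hTS, rfl⟩
    exact ⟨T, hT, by rw [← hT.1.2, hTS, hS.2], rfl⟩
  · rw [omB_eq_zero hS]
    exact zero_mem _

lemma deg_rank_le_span_mixedForm (hunmixed : A.unmixedOrd 1)
    (hlam : ∀ X, A.memL X → X ≠ A.amb → A.denseL X → A.lamX lam X ≠ 0) :
    A.deg A.rank ≤ Submodule.span ℂ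
      (Set.range fun B : {B : Finset (Fin n) // A.IsNbc B ∧ A.isBase B} =>
        A.mixedForm lam B.1) := by
  rw [deg, Submodule.span_le]
  rintro _ ⟨S, hS, rfl⟩
  refine Submodule.span_le.2 ?_ (omB_mem_span_flagForm hlam S)
  rintro _ ⟨T, hT, hTS, rfl⟩
  exact flagForm_mem_span_mixedForm hunmixed hlam hT (hT.isBase_of_card (hTS.trans hS))

lemma linearIndependent_mixedForm (hunmixed : A.unmixedOrd 1)
    (hlam : ∀ X, A.memL X → X ≠ A.amb → A.denseL X → A.lamX lam X ≠ 0) :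
    LinearIndependent ℂ fun B : {B : Finset (Fin n) // A.IsNbc B ∧ A.isBase B} =>
      A.mixedForm lam B.1 := by
  classical
  rw [linearIndependent_iff_card_le_finrank_span, ← finrank_span_eq_card linearIndependent_nbc]
  have : FiniteDimensional ℂ (Submodule.span ℂ
      (Set.range fun B : {B : Finset (Fin n) // A.IsNbc B ∧ A.isBase B} =>
        A.mixedForm lam B.1)) := FiniteDimensional.span_of_finite ℂ (Set.finite_range _)
  refine Submodule.finrank_mono (le_trans ?_ (deg_rank_le_span_mixedForm hunmixed hlam))
  rw [Submodule.span_le]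
  rintro _ ⟨B, rfl⟩
  exact Submodule.subset_span ⟨B.1, (isBase_iff.1 B.2.2).2, rfl⟩

lemma linearIndependent_betaNbc : LinearIndependent ℂ
    fun B : {S : Finset (Fin n) // A.betaNbcBase 1 S} => A.omB B.1 := by
  let f : {S : Finset (Fin n) // A.betaNbcBase 1 S} →
      {B : Finset (Fin n) // A.IsNbc B ∧ A.isBase B} :=
    fun B => ⟨B.1, (betaNbcBase_one_iff.1 B.2).1⟩
  have hf : Function.Injective f := fun B B' h => Subtype.ext (congrArg (fun x => x.1) h)
  exact linearIndependent_nbc.comp f hf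

/-- In positive rank, `ω_λ A^{r-1}` is generated by the mixed forms that are not monomials. -/
lemma Ideg_le_span_mixedForm
    (hlam : ∀ X, A.memL X → X ≠ A.amb → A.denseL X → A.lamX lam X ≠ 0) :
    A.Ideg lam (A.rank - 1) ≤ Submodule.span ℂ
      ((fun B : {B : Finset (Fin n) // A.IsNbc B ∧ A.isBase B} => A.mixedForm lam B.1) ''
        {B | ¬ ∀ i ∈ B.1, A.Movable B.1 i}) := by
  rcases Nat.eq_zero_or_pos A.rank with h0 | hpos
  · have hz : A.omLam lam = 0 := by
      refine Finset.sum_eq_zero fun i _ => ?_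
      have := (indep_singleton (A := A) i).card_le_rank
      simp [h0] at this
    rw [Ideg, hz]
    rintro _ ⟨x, -, rfl⟩
    simp
  rw [Ideg, deg, Submodule.map_span_le]
  rintro _ ⟨S, hS, rfl⟩
  rw [LinearMap.mulLeft_apply]
  refine Submodule.span_induction (p := fun x _ => A.omLam lam * x ∈ _) ?_ (by simp) ?_ ?_
    (omB_mem_span_flagForm hlam S)
  · rintro _ ⟨T, hT, hTS, rfl⟩
    refine omLam_mul_flagForm_mem lam ?_ hT (by omega)
    intro B hn hb hex
    have hnf : ¬ ∀ i ∈ B, A.Movable B i := by push Not; exact hex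
    obtain ⟨i, h1, h2, h3⟩ := exists_mixedForm_eq lam hnf
    exact ⟨i, h1, h2, Submodule.subset_span ⟨⟨B, hn, hb⟩, hnf, h3⟩⟩
  · intro x y _ _ hx hy
    rw [mul_add]
    exact add_mem hx hy
  · intro a x _ hx
    rw [mul_smul_comm]
    exact Submodule.smul_mem _ _ hx

lemma mixedForm_mem_Ideg {B : Finset (Fin n)} (hb : A.isBase B)
    (hn : A.IsNbc B) (hB : ¬ ∀ i ∈ B, A.Movable B i) :
    A.mixedForm lam B ∈ A.Ideg lam (A.rank - 1) := by
  classical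
  obtain ⟨i, h1, -, h3⟩ := exists_mixedForm_eq lam hB
  rw [h3]
  have hE := (hn.subset (Finset.erase_subset i B)).1
  refine ⟨_, ?_, rfl⟩
  refine (Submodule.span_le.2 ?_ : A.flatPart _ ≤ _) (flagForm_mem_flatPart lam hE)
  rintro _ ⟨T, hT, hTE, rfl⟩
  refine Submodule.subset_span ⟨T, ?_, rfl⟩
  rw [← hT.2, hTE, hE.2, Finset.card_erase_of_mem h1, (isBase_iff.1 hb).2]

end Assembly

end HArr

open scoped Classical
/-- If the linear order on `𝒜` is unmixed and `λ(X) ≠ 0` for all dense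
`X ∈ L ∖ {V}`, then the residue classes `{[ω_B] : B ∈ βnbc(𝒜)}` form a ℂ-basis of
`A^r/(ω_λ ∧ A^{r−1})`. -/
theorem monomial_basis_of_unmixed {W : Type} [AddCommGroup W] [Module ℂ W]
    [FiniteDimensional ℂ W] {n : ℕ} (A : HArr W n) (lam : Fin n → ℂ)
    (hunmixed : A.unmixedOrd 1)
    (hlam : ∀ X, A.memL X → X ≠ A.amb → A.denseL X → A.lamX lam X ≠ 0) :
    (∀ c : {S : Finset (Fin n) // A.betaNbcBase 1 S} → ℂ,
      (∑ B, c B • A.omB B.1) ∈ A.Ideg lam (A.rank - 1) → ∀ B, c B = 0) ∧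
    A.deg A.rank ≤
      Submodule.span ℂ
        (Set.range fun B : {S : Finset (Fin n) // A.betaNbcBase 1 S} => A.omB B.1) ⊔
      A.Ideg lam (A.rank - 1) := by
  constructor
  · intro c hc
    refine Fintype.linearIndependent_iff.1 HArr.linearIndependent_betaNbc c ?_
    have hdisj : Disjoint {B : {B : Finset (Fin n) // A.IsNbc B ∧ A.isBase B} |
        ∀ i ∈ B.1, A.Movable B.1 i} {B | ¬ ∀ i ∈ B.1, A.Movable B.1 i} := disjoint_compl_right
    refine Submodule.disjoint_def.1
      ((HArr.linearIndependent_mixedForm hunmixed hlam).disjoint_span_image hdisj) _ ?_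
      (HArr.Ideg_le_span_mixedForm hlam hc)
    refine Submodule.sum_mem _ fun B _ => Submodule.smul_mem _ _ (Submodule.subset_span ?_)
    obtain ⟨h1, h2⟩ := HArr.betaNbcBase_one_iff.1 B.2
    exact ⟨⟨B.1, h1⟩, h2, HArr.mixedForm_of_movable lam h2⟩
  · refine (HArr.deg_rank_le_span_mixedForm hunmixed hlam).trans ?_
    rw [Submodule.span_le]
    rintro _ ⟨⟨B, hn, hb⟩, rfl⟩
    by_cases hfull : ∀ i ∈ B, A.Movable B i
    · refine Submodule.mem_sup_left (Submodule.subset_span ?_)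
      exact ⟨⟨B, HArr.betaNbcBase_one_iff.2 ⟨⟨hn, hb⟩, hfull⟩⟩,
        (HArr.mixedForm_of_movable lam hfull).symm⟩
    · exact Submodule.mem_sup_right (HArr.mixedForm_mem_Ideg hb hn hfull)
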